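/- arXiv:0811.4346 — 9 statements merged into one kernel-verified Lean document; each statement's English description precedes it below -/
import Mathlib

section
/- For all integers n ≥ 2 and t ≥ 1, the minimum ball-shuffling cost satisfies f_t(n) > n·(log_{2t} n − 1)/2. In particular, the cost of any algorithm for the ball-shuffling problem with n balls and t bins is Ω(n·log n / log t) (part (i) of the ball-shuffling lower bound theorem). -/
/-- One shuffle step in the ball-shuffling problem with `t` bins:
a set `I` of bins is emptied, the new ball is added to the collected balls,
and the collected balls are redistributed among bins that are empty after the
collection (bins not in `I` that are nonempty keep their contents).
The cost is `(∑ i ∈ I, b i) + 1`. -/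
def ShuffleStep (t : ℕ) (b b' : Fin t → ℕ) (c : ℕ) : Prop :=
  ∃ I : Finset (Fin t),
    c = (∑ i ∈ I, b i) + 1 ∧
    (∀ i, i ∉ I → b i ≠ 0 → b' i = b i) ∧
    (∑ i, b' i) = (∑ i, b i) + 1

/-- An algorithm (run) for the ball-shuffling problem with `t` bins and `n` balls:
a sequence of configurations starting from all-empty bins, where the `k`-th step
is a valid shuffle of cost `c k`. -/
def IsRun (t n : ℕ) (b : ℕ → Fin t → ℕ) (c : ℕ → ℕ) : Prop :=
  (∀ i, b 0 i = 0) ∧ ∀ k, k < n → ShuffleStep t (b k) (b (k + 1)) (c k)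

/-- `shuffleCost t n` is the minimum total cost of any algorithm for the
ball-shuffling problem with `n` balls and `t` bins. -/
noncomputable def shuffleCost (t n : ℕ) : ℕ :=
  sInf { s | ∃ b c, IsRun t n b c ∧ s = ∑ k ∈ Finset.range n, c k }

open Finset in
/-- Any family of prescribed fiber sizes with the right total is realized by a function. -/
lemma exists_fiber_card_eq {α ι : Type*} [Fintype ι] [DecidableEq ι] [Nonempty ι]
    (S : Finset α) (d : ι → ℕ) (h : ∑ i, d i = #S) :
    ∃ g : α → ι, ∀ i, #{s ∈ S | g s = i} = d i := by
  classical
  have e : S ≃ Σ i, Fin (d i) := Fintype.equivOfCardEq (by simp [h])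
  refine ⟨fun a => if ha : a ∈ S then (e ⟨a, ha⟩).1 else Classical.arbitrary ι, fun i => ?_⟩
  rw [← Fintype.card_fin (d i), ← Finset.card_univ]
  symm
  refine Finset.card_bij (fun x _ => (e.symm ⟨i, x⟩ : α)) ?_ ?_ ?_
  · intro x _
    simp
  · intro x _ y _ hxy
    simpa using hxy
  · intro a ha
    obtain ⟨haS, hai⟩ := Finset.mem_filter.1 ha
    simp only [haS, dite_true] at hai
    subst hai
    exact ⟨(e ⟨a, haS⟩).2, mem_univ _, by simp⟩

open Finset in
/-- A shuffle of `k` labelled balls, with labels `s < k` and positions `f`, can be refined to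
one that tracks the labels, the new ball receiving the label `k`. -/
lemma ShuffleStep.exists_labelled {t k c : ℕ} [NeZero t] {b b' : Fin t → ℕ}
    (h : ShuffleStep t b b' c) (f : ℕ → Fin t) (hf : ∀ i, #{s ∈ range k | f s = i} = b i) :
    ∃ f' : ℕ → Fin t, (∀ i, #{s ∈ range (k + 1) | f' s = i} = b' i) ∧
      ∃ I : Finset (Fin t), c = #{s ∈ range k | f s ∈ I} + 1 ∧
        ∀ s < k, f s ∉ I → f' s = f s ∧
          ∀ s' ≤ k, f' s' = f s → s' < k ∧ f s' = f s := by
  obtain ⟨I, hc, hkeep, hsum⟩ := h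
  have hI : #{s ∈ range k | f s ∈ I} = ∑ i ∈ I, b i := by
    rw [card_eq_sum_card_fiberwise (f := f) (t := I) (by intro s hs; simpa using (mem_filter.1 hs).2)]
    refine sum_congr rfl fun i hi => ?_
    rw [← hf i, filter_filter]
    congr 1
    ext s
    simp only [mem_filter]
    constructor
    · tauto
    · rintro ⟨h1, rfl⟩
      exact ⟨h1, hi, rfl⟩
  set S : Finset ℕ := insert k {s ∈ range k | f s ∈ I} with hS
  have hScard : #S = ∑ i ∈ I, b i + 1 := by
    rw [hS, card_insert_of_notMem (by simp), hI]
  set d : Fin t → ℕ := fun i => if i ∉ I ∧ b i ≠ 0 then 0 else b' i with hd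
  have hb' : ∀ i, d i + (if i ∈ I then 0 else b i) = b' i := by
    intro i
    have := hkeep i
    simp only [hd]
    by_cases hi : i ∈ I <;> by_cases hbi : b i = 0 <;> simp_all
  have hdsum : ∑ i, d i = #S := by
    have h1 : ∑ i, d i + ∑ i, (if i ∈ I then 0 else b i) = ∑ i, b' i := by
      rw [← sum_add_distrib]
      exact sum_congr rfl fun i _ => hb' i
    have h2 : ∑ i ∈ I, b i + ∑ i, (if i ∈ I then 0 else b i) = ∑ i, b i := by
      rw [← Finset.sum_filter_add_sum_filter_not univ (· ∈ I) b]
      congr 1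
      · congr 1; ext; simp
      · rw [sum_filter]
        refine sum_congr rfl fun i _ => ?_
        split_ifs <;> rfl
    omega
  obtain ⟨g, hg⟩ := exists_fiber_card_eq S d hdsum
  refine ⟨fun s => if s ∈ S then g s else f s, fun i => ?_, I, by rw [hI, hc], ?_⟩
  · rw [← hb' i, ← hg i]
    have h3 : (if i ∈ I then 0 else b i) = #{s ∈ range k | f s = i ∧ f s ∉ I} := by
      split_ifs with hi
      · symm
        rw [card_eq_zero, filter_eq_empty_iff]
        rintro s _ ⟨rfl, h⟩
        exact h hi
      · rw [← hf i]
        congr 1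
        ext s
        simp only [mem_filter]
        constructor
        · rintro ⟨h1, rfl⟩
          exact ⟨h1, rfl, hi⟩
        · tauto
    rw [h3, ← card_union_of_disjoint]
    · congr 1
      ext s
      simp only [hS, mem_filter, mem_union, mem_insert, mem_range]
      have : s < k + 1 ↔ s = k ∨ s < k := by omega
      split_ifs <;> grind
    · rw [disjoint_left]
      intro s
      simp only [hS, mem_filter, mem_insert, mem_range]
      rintro ⟨h1 | h1, -⟩ h2
      · omega
      · exact h2.2.2 h1.2
  · intro s hs hsI
    have hbs : b (f s) ≠ 0 := by
      rw [← hf, ← Nat.pos_iff_ne_zero, card_pos]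
      exact ⟨s, by simp [hs]⟩
    have hsS : s ∉ S := by simp [hS, hsI, hs.ne]
    refine ⟨by simp [hsS], fun s' hs' => ?_⟩
    by_cases hs'S : s' ∈ S
    · simp only [hs'S, if_true]
      intro h
      have h0 : #{x ∈ S | g x = f s} = 0 := by rw [hg]; simp [hd, hsI, hbs]
      rw [card_eq_zero, filter_eq_empty_iff] at h0
      exact absurd h (h0 hs'S)
    · simp only [hs'S, if_false]
      intro h
      refine ⟨?_, h⟩
      have : s' ≠ k := by rintro rfl; simp [hS] at hs'S
      omega

open Finset in
/-- The balls of a run can be labelled by their arrival times, with positions `pos` and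
a relation `T s k` saying that ball `s` is moved by the `k`-th shuffle. -/
lemma IsRun.exists_labelling {t n : ℕ} [NeZero t] {b : ℕ → Fin t → ℕ} {c : ℕ → ℕ}
    (h : IsRun t n b c) :
    ∃ (pos : ℕ → ℕ → Fin t) (T : ℕ → Set ℕ), ∀ k < n,
      (∀ [DecidablePred (· ∈ T k)], c k = #{s ∈ range k | s ∈ T k} + 1) ∧
      ∀ s < k, s ∉ T k → pos (k + 1) s = pos k s ∧
        ∀ s' ≤ k, pos (k + 1) s' = pos k s → s' < k ∧ pos k s' = pos k s := by
  classical
  obtain ⟨h0, hstep⟩ := h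
  have key : ∀ (k : ℕ) (f : ℕ → Fin t), ∃ f' : ℕ → Fin t,
      k < n → (∀ i, #{s ∈ range k | f s = i} = b k i) →
      (∀ i, #{s ∈ range (k + 1) | f' s = i} = b (k + 1) i) ∧
      ∃ I : Finset (Fin t), c k = #{s ∈ range k | f s ∈ I} + 1 ∧
        ∀ s < k, f s ∉ I → f' s = f s ∧
          ∀ s' ≤ k, f' s' = f s → s' < k ∧ f s' = f s := by
    intro k f
    by_cases hk : k < n ∧ ∀ i, #{s ∈ range k | f s = i} = b k i
    · obtain ⟨f', hf'⟩ := (hstep k hk.1).exists_labelled f hk.2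
      exact ⟨f', fun _ _ => hf'⟩
    · exact ⟨f, fun h1 h2 => absurd ⟨h1, h2⟩ hk⟩
  choose next hnext using key
  let pos : ℕ → ℕ → Fin t := @Nat.rec (fun _ => ℕ → Fin t) (fun _ => 0) next
  have hpos : ∀ k ≤ n, ∀ i : Fin t, #{s ∈ range k | pos k s = i} = b k i := by
    intro k
    induction k with
    | zero => intro _ i; simp [h0]
    | succ k ih => intro hk; exact (hnext k (pos k) hk (ih (by omega))).1
  have hI : ∀ k, ∃ I : Finset (Fin t), k < n → c k = #{s ∈ range k | pos k s ∈ I} + 1 ∧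
        ∀ s < k, pos k s ∉ I → pos (k + 1) s = pos k s ∧
          ∀ s' ≤ k, pos (k + 1) s' = pos k s → s' < k ∧ pos k s' = pos k s := by
    intro k
    by_cases hk : k < n
    · obtain ⟨I, hI⟩ := (hnext k (pos k) hk (hpos k hk.le)).2
      exact ⟨I, fun _ => hI⟩
    · exact ⟨∅, fun h => absurd h hk⟩
  choose I hI using hI
  refine ⟨pos, fun k => {s | pos k s ∈ I k}, fun k hk => ⟨?_, (hI k hk).2⟩⟩
  intro _
  rw [(hI k hk).1]
  congr 2
  ext; simp

open Finset Classical in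
/-- In a window of `2 * t` consecutive blocks of `B` shuffles, at least `t * B` of the balls
arriving in the window are moved again during a later block of the window. -/
lemma card_moved_in_later_block {t n : ℕ} (pos : ℕ → ℕ → Fin t) (T : ℕ → Set ℕ)
    (hpos : ∀ k < n, ∀ s < k, s ∉ T k → pos (k + 1) s = pos k s ∧
        ∀ s' ≤ k, pos (k + 1) s' = pos k s → s' < k ∧ pos k s' = pos k s)
    (B w : ℕ) (hw : (w + 1) * (2 * t * B) ≤ n) :
    t * B ≤ #{s ∈ Ico (w * (2 * t * B)) ((w + 1) * (2 * t * B)) |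
      ∃ k < (w + 1) * (2 * t * B), s / B < k / B ∧ s ∈ T k} := by
  classical
  rcases Nat.eq_zero_or_pos B with rfl | hB
  · simp
  set E := (w + 1) * (2 * t * B) with hE
  have hEB : E = ((w + 1) * (2 * t)) * B := by rw [hE]; ring
  have hAB : w * (2 * t * B) = (w * (2 * t)) * B := by ring
  set G : ℕ → Prop := fun s => ∃ k < E, s / B < k / B ∧ s ∈ T k with hG
  set J := Ico (w * (2 * t)) ((w + 1) * (2 * t)) with hJ
  have hJcard : #J = 2 * t := by rw [hJ, Nat.card_Ico, add_mul]; omega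
  have hJs : ∀ s, s ∈ Ico (w * (2 * t * B)) E ↔ s / B ∈ J := by
    intro s
    rw [hJ, mem_Ico, mem_Ico, hEB, hAB, Nat.le_div_iff_mul_le hB, Nat.div_lt_iff_lt_mul hB]
  set bad := {j ∈ J | ∃ s, s / B = j ∧ ¬ G s} with hbad
  -- a ball resting from the end of its block on keeps later balls out of its bin
  have stay : ∀ s, ¬ G s → ∀ k, (s / B + 1) * B ≤ k → k ≤ E →
      ∀ s', (s / B + 1) * B ≤ s' → s' < k → pos k s' ≠ pos k s := by
    intro s hs k hk
    induction k, hk using Nat.le_induction with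
    | base => intro _ s' h1 h2; omega
    | succ k hk ih =>
      intro hkE s' h1 h2 heq
      have hlt : s / B < k / B := (Nat.le_div_iff_mul_le hB).2 hk
      have hsk : s < k := lt_of_lt_of_le (by
        have := Nat.lt_div_mul_add (a := s) hB
        rw [add_mul, one_mul]; exact this) hk
      have hsT : s ∉ T k := fun h => hs ⟨k, hkE, hlt, h⟩
      obtain ⟨e1, e2⟩ := hpos k (by omega) s hsk hsT
      obtain ⟨e3, e4⟩ := e2 s' (by omega) (heq.trans e1)
      exact ih (by omega) s' h1 e3 e4
  have hbadcard : #bad ≤ t := by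
    have hch : ∀ j, ∃ s, j ∈ bad → s / B = j ∧ ¬ G s := by
      intro j
      by_cases hj : j ∈ bad
      · obtain ⟨s, hs⟩ := (mem_filter.1 hj).2
        exact ⟨s, fun _ => hs⟩
      · exact ⟨0, fun h => absurd h hj⟩
    choose σ hσ using hch
    have hlt : ∀ j ∈ bad, ∀ j' ∈ bad, j < j' → pos E (σ j') ≠ pos E (σ j) := by
      intro j hj j' hj' hjj
      obtain ⟨e1, e2⟩ := hσ j hj
      obtain ⟨e1', e2'⟩ := hσ j' hj'
      have hle : (σ j / B + 1) * B ≤ σ j' := by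
        rw [← Nat.le_div_iff_mul_le hB, e1, e1']; exact hjj
      have hltE : σ j' < E :=
        (mem_Ico.1 ((hJs _).2 (by rw [e1']; exact (mem_filter.1 hj').1))).2
      exact stay _ e2 E (hle.trans hltE.le) le_rfl _ hle hltE
    calc #bad ≤ #(univ : Finset (Fin t)) := by
          refine card_le_card_of_injOn (fun j => pos E (σ j)) (fun _ _ => mem_univ _) ?_
          intro j hj j' hj' heq
          rcases lt_trichotomy j j' with hl | hl | hl
          · exact absurd heq.symm (hlt j hj j' hj' hl)
          · exact hl
          · exact absurd heq (hlt j' hj' j hj hl)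
      _ = t := by simp
  have hgood : t ≤ #(J \ bad) := by
    have := le_card_sdiff bad J
    omega
  calc t * B ≤ ∑ j ∈ J \ bad, #(Ico (j * B) ((j + 1) * B)) := by
        simp only [Nat.card_Ico, ← Nat.sub_mul, Nat.add_sub_cancel_left, one_mul, sum_const,
          smul_eq_mul]
        exact Nat.mul_le_mul_right _ hgood
    _ = #((J \ bad).biUnion fun j => Ico (j * B) ((j + 1) * B)) := by
        rw [card_biUnion]
        intro j _ j' _ hne
        refine disjoint_left.2 fun s h1 h2 => hne ?_
        rw [mem_Ico, ← Nat.le_div_iff_mul_le hB, ← Nat.div_lt_iff_lt_mul hB] at h1 h2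
        omega
    _ ≤ _ := by
        refine card_le_card fun s hs => ?_
        obtain ⟨j, hj, hsj⟩ := mem_biUnion.1 hs
        rw [mem_Ico, ← Nat.le_div_iff_mul_le hB, ← Nat.div_lt_iff_lt_mul hB] at hsj
        have hsj' : s / B = j := by omega
        rw [mem_sdiff] at hj
        refine mem_filter.2 ⟨(hJs s).2 (hsj' ▸ hj.1), ?_⟩
        by_contra hns
        exact hj.2 (mem_filter.2 ⟨hj.1, s, hsj', hns⟩)

open Finset in
/-- The moves of a ball to a different block of size `B` but within the same window of `2 * t`
blocks number at least `t * B` per window. -/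
lemma card_moves_add_le {t n : ℕ} (ht : 1 ≤ t) (pos : ℕ → ℕ → Fin t) (T : ℕ → Set ℕ)
    (hpos : ∀ k < n, ∀ s < k, s ∉ T k → pos (k + 1) s = pos k s ∧
        ∀ s' ≤ k, pos (k + 1) s' = pos k s → s' < k ∧ pos k s' = pos k s)
    {B : ℕ} (hB : 0 < B) (P : Finset (ℕ × ℕ))
    (hP : ∀ s k, s < k → k < n → s ∈ T k → (s, k) ∈ P) :
    #{p ∈ P | p.1 / (2 * t * B) ≠ p.2 / (2 * t * B)} + n / (2 * t * B) * (t * B) ≤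
      #{p ∈ P | p.1 / B ≠ p.2 / B} := by
  classical
  set M := 2 * t * B with hM
  have hMpos : 0 < M := by positivity
  have hdiv : ∀ a, a / M = a / B / (2 * t) := fun a => by
    rw [hM, mul_comm, Nat.div_div_eq_div_mul]
  set Q := {p ∈ P | p.1 / B ≠ p.2 / B ∧ p.1 / M = p.2 / M} with hQ
  have hQcard : n / M * (t * B) ≤ #Q := by
    have hw : ∀ w ∈ range (n / M), t * B ≤ #{p ∈ Q | p.1 / M = w} := by
      intro w hw
      have hwn : (w + 1) * M ≤ n := by
        rw [← Nat.le_div_iff_mul_le hMpos]; exact mem_range.1 hw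
      refine (card_moved_in_later_block pos T hpos B w hwn).trans ?_
      rw [← hM]
      refine le_trans (card_le_card ?_) (card_image_le (s := {p ∈ Q | p.1 / M = w}) (f := Prod.fst))
      intro s hs
      obtain ⟨hs1, k, hk, hlt, hsT⟩ := mem_filter.1 hs
      rw [mem_Ico, ← Nat.le_div_iff_mul_le hMpos, ← Nat.div_lt_iff_lt_mul hMpos] at hs1
      have hsk : s < k := by
        by_contra h
        exact absurd (Nat.div_le_div_right (c := B) (not_lt.1 h)) (not_le.2 hlt)
      have hsw : s / M = w := by omega
      have hkw : k / M = w := by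
        have h1 := Nat.div_le_div_right (c := M) hsk.le
        rw [← Nat.div_lt_iff_lt_mul hMpos] at hk
        omega
      refine mem_image.2 ⟨(s, k), ?_, rfl⟩
      simp only [hQ, mem_filter]
      exact ⟨⟨hP s k hsk (by omega) hsT, hlt.ne, hsw.trans hkw.symm⟩, hsw⟩
    calc n / M * (t * B) = ∑ _w ∈ range (n / M), t * B := by simp
      _ ≤ ∑ w ∈ range (n / M), #{p ∈ Q | p.1 / M = w} := sum_le_sum hw
      _ = #((range (n / M)).biUnion fun w => {p ∈ Q | p.1 / M = w}) := by
        rw [card_biUnion]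
        intro w _ w' _ hne
        refine disjoint_left.2 fun p h1 h2 => hne ?_
        rw [← (mem_filter.1 h1).2, ← (mem_filter.1 h2).2]
      _ ≤ #Q := card_le_card (biUnion_subset.2 fun w _ => filter_subset _ _)
  refine (Nat.add_le_add_left hQcard _).trans ?_
  rw [← card_union_of_disjoint]
  · refine card_le_card fun p hp => ?_
    simp only [hQ, mem_union, mem_filter] at hp ⊢
    rcases hp with ⟨h1, h2⟩ | ⟨h1, h2, _⟩
    · exact ⟨h1, fun h => h2 (by rw [hdiv, hdiv, h])⟩
    · exact ⟨h1, h2⟩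
  · refine disjoint_left.2 fun p h1 h2 => ?_
    exact (mem_filter.1 h1).2 (mem_filter.1 h2).2.2

/-- Twice the cost of a run is at least `n * Nat.log (2 * t) n`. -/
lemma IsRun.mul_log_le_two_mul_sum {t n : ℕ} (hn : n ≠ 0) (ht : 1 ≤ t) {b : ℕ → Fin t → ℕ}
    {c : ℕ → ℕ} (h : IsRun t n b c) :
    n * Nat.log (2 * t) n ≤ 2 * ∑ k ∈ Finset.range n, c k := by
  classical
  have : NeZero t := ⟨by omega⟩
  obtain ⟨pos, T, hT⟩ := h.exists_labelling
  set P : Finset (ℕ × ℕ) :=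
    {p ∈ Finset.range n ×ˢ Finset.range n | p.1 < p.2 ∧ p.1 ∈ T p.2} with hPdef
  have hcost : ∑ k ∈ Finset.range n, c k = P.card + n := by
    have h1 : P.card = ∑ k ∈ Finset.range n, (Finset.filter (· ∈ T k) (Finset.range k)).card := by
      rw [Finset.card_eq_sum_card_fiberwise (f := Prod.snd) (t := Finset.range n)
        (by intro p hp; simp [hPdef] at hp ⊢; exact hp.1.2)]
      refine Finset.sum_congr rfl fun k hk => ?_
      refine Finset.card_bij (fun p _ => p.1) ?_ ?_ ?_
      · rintro ⟨s, k'⟩ hp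
        simp only [hPdef, Finset.mem_filter, Finset.mem_range] at hp ⊢
        obtain ⟨hp, rfl⟩ := hp
        exact hp.2
      · rintro ⟨s, k'⟩ hp ⟨s', k''⟩ hp' heq
        have e1 := (Finset.mem_filter.1 hp).2
        have e2 := (Finset.mem_filter.1 hp').2
        exact Prod.ext heq (e1.trans e2.symm)
      · intro s hs
        simp only [Finset.mem_filter, Finset.mem_range] at hs hk
        refine ⟨(s, k), ?_, rfl⟩
        simp only [hPdef, Finset.mem_filter, Finset.mem_product, Finset.mem_range]
        exact ⟨⟨⟨by omega, hk⟩, hs⟩, trivial⟩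
    rw [h1, Finset.sum_congr rfl fun k hk => (hT k (Finset.mem_range.1 hk)).1,
      Finset.sum_add_distrib]
    simp
  have hP : ∀ s k, s < k → k < n → s ∈ T k → (s, k) ∈ P := by
    intro s k h1 h2 h3
    simp only [hPdef, Finset.mem_filter, Finset.mem_product, Finset.mem_range]
    exact ⟨⟨by omega, h2⟩, h1, h3⟩
  set m := 2 * t with hm
  have hm2 : 2 ≤ m := by omega
  have hlevel : ∀ j, n * j + 2 ≤
      2 * (P.card - (P.filter fun p => p.1 / m ^ j ≠ p.2 / m ^ j).card) + 2 * m ^ j ∧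
      (P.filter fun p => p.1 / m ^ j ≠ p.2 / m ^ j).card ≤ P.card := by
    intro j
    refine ⟨?_, Finset.card_filter_le _ _⟩
    induction j with
    | zero => simp
    | succ j ih =>
      have hstep := card_moves_add_le ht pos T (fun k hk => (hT k hk).2)
        (B := m ^ j) (by positivity) P hP
      rw [← hm, ← pow_succ'] at hstep
      have hle := Finset.card_filter_le P fun p => p.1 / m ^ j ≠ p.2 / m ^ j
      have hlt : n < n / m ^ (j + 1) * m ^ (j + 1) + m ^ (j + 1) :=
        Nat.lt_div_mul_add (by positivity)
      have hdbl : n / m ^ (j + 1) * m ^ (j + 1) = 2 * (n / m ^ (j + 1) * (t * m ^ j)) := by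
        nth_rewrite 2 [pow_succ']
        rw [hm]; ring
      have hgrow : 2 * m ^ j ≤ m ^ (j + 1) := by
        rw [pow_succ']; exact Nat.mul_le_mul_right _ hm2
      rw [Nat.mul_succ]
      omega
  obtain ⟨hl, hle⟩ := hlevel (Nat.log m n)
  have hpow := Nat.pow_log_le_self m hn
  omega

/-- Keeping all balls in a single bin is a valid run. -/
lemma exists_isRun (t n : ℕ) [NeZero t] : ∃ b c, IsRun t n b c := by
  refine ⟨fun k => Pi.single 0 k, fun k => k + 1, by simp, fun k _ => ⟨Finset.univ, ?_, ?_, ?_⟩⟩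
  · simp
  · simp
  · simp

/-- Part (i) of the ball-shuffling lower bound: for all integers n ≥ 2 and t ≥ 1,
the minimum ball-shuffling cost satisfies f_t(n) > n·(log_{2t} n − 1)/2. -/
theorem ball_shuffling_lower_bound_part_i (n t : ℕ) (hn : 2 ≤ n) (ht : 1 ≤ t) :
    (shuffleCost t n : ℝ) > (n : ℝ) * (Real.logb (2 * (t : ℝ)) (n : ℝ) - 1) / 2 := by
  have : NeZero t := ⟨by omega⟩
  obtain ⟨b₀, c₀, h₀⟩ := exists_isRun t n
  obtain ⟨b, c, hrun, hcost⟩ : shuffleCost t n ∈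
      { s | ∃ b c, IsRun t n b c ∧ s = ∑ k ∈ Finset.range n, c k } :=
    Nat.sInf_mem ⟨_, b₀, c₀, h₀, rfl⟩
  have hlow := hrun.mul_log_le_two_mul_sum (by omega) ht
  rw [← hcost] at hlow
  have hlow' : (n : ℝ) * Nat.log (2 * t) n ≤ 2 * shuffleCost t n := by exact_mod_cast hlow
  have hlog : Real.logb (2 * (t : ℝ)) n < Nat.log (2 * t) n + 1 := by
    have h1 : (1 : ℝ) < 2 * t := by
      have : (1 : ℝ) ≤ t := by exact_mod_cast ht
      linarith
    rw [Real.logb_lt_iff_lt_rpow h1 (by positivity)]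
    have h2 := Nat.lt_pow_succ_log_self (b := 2 * t) (by omega) n
    exact_mod_cast h2
  have hn' : (0 : ℝ) < n := by positivity
  have := mul_lt_mul_of_pos_left hlog hn'
  linarith
end

section
/- For every constant α > 0 there exist constants c > 0 and ε > 0 such that for all integers n ≥ 2 and all integers t with 1 ≤ t < α·ln n, the minimum ball-shuffling cost satisfies f_t(n) ≥ c·t·n^{1+ε/t} (part (ii) of the ball-shuffling lower bound theorem). -/
section FractionalRuns

variable {ι : Type*}

/-- A run of `n` shuffles with real-valued bin contents, an arbitrary initial configuration, and
shuffled sets `I k` contained in `S`. -/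
structure IsFracRun (S : Finset ι) (n : ℕ) (b : ℕ → ι → ℝ) (I : ℕ → Finset ι) : Prop where
  nonneg : ∀ k i, 0 ≤ b k i
  subset : ∀ k < n, I k ⊆ S
  eq_of_notMem : ∀ k < n, ∀ i ∉ I k, b (k + 1) i = b k i
  sum_succ : ∀ k < n, ∑ i ∈ I k, b (k + 1) i = ∑ i ∈ I k, b k i + 1

/-- The total cost of the first `n` shuffles. -/
noncomputable def fracCost (n : ℕ) (b : ℕ → ι → ℝ) (I : ℕ → Finset ι) : ℝ :=
  ∑ k ∈ Finset.range n, (∑ i ∈ I k, b k i + 1)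

namespace IsFracRun

variable {S : Finset ι} {n : ℕ} {b : ℕ → ι → ℝ} {I : ℕ → Finset ι}

lemma mono (h : IsFracRun S n b I) {m : ℕ} (hm : m ≤ n) : IsFracRun S m b I :=
  ⟨h.nonneg, fun k hk => h.subset k (by omega), fun k hk => h.eq_of_notMem k (by omega),
    fun k hk => h.sum_succ k (by omega)⟩

lemma shift {m₁ m₂ : ℕ} (h : IsFracRun S (m₁ + m₂) b I) :
    IsFracRun S m₂ (fun k => b (m₁ + k)) (fun k => I (m₁ + k)) :=
  ⟨fun k => h.nonneg _, fun k hk => h.subset _ (by omega),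
    fun k hk => h.eq_of_notMem (m₁ + k) (by omega), fun k hk => h.sum_succ (m₁ + k) (by omega)⟩

lemma natCast_le_fracCost (h : IsFracRun S n b I) : (n : ℝ) ≤ fracCost n b I := by
  have : ∑ _k ∈ Finset.range n, (1 : ℝ) ≤ fracCost n b I :=
    Finset.sum_le_sum fun k _ => by
      have := Finset.sum_nonneg fun i (_ : i ∈ I k) => h.nonneg k i
      linarith
  simpa using this

end IsFracRun

variable [DecidableEq ι]

/-- The part of the contents of the bins that arrived after time `0`. -/
noncomputable def newBalls (b : ℕ → ι → ℝ) (I : ℕ → Finset ι) : ℕ → ι → ℝ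
  | 0, _ => 0
  | k + 1, i => if i ∈ I k then
      b (k + 1) i * ((∑ j ∈ I k, newBalls b I k j + 1) / (∑ j ∈ I k, b k j + 1))
    else newBalls b I k i

namespace IsFracRun

variable {S : Finset ι} {n : ℕ} {b : ℕ → ι → ℝ} {I : ℕ → Finset ι}

lemma natCast_le_sum (h : IsFracRun S n b I) : ∀ k ≤ n, (k : ℝ) ≤ ∑ i ∈ S, b k i := by
  intro k
  induction k with
  | zero => exact fun _ => by simpa using Finset.sum_nonneg fun i _ => h.nonneg 0 i
  | succ k ih =>
    intro hk
    have h1 := ih (by omega)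
    have hS := h.subset k (by omega)
    have h2 : ∑ i ∈ S \ I k, b (k + 1) i = ∑ i ∈ S \ I k, b k i :=
      Finset.sum_congr rfl fun i hi =>
        h.eq_of_notMem k (by omega) i (Finset.mem_sdiff.1 hi).2
    rw [← Finset.sum_sdiff hS] at h1 ⊢
    push_cast
    linarith [h.sum_succ k (by omega)]

lemma newBalls_nonneg (h : IsFracRun S n b I) (k : ℕ) (i : ι) : 0 ≤ newBalls b I k i := by
  induction k generalizing i with
  | zero => simp [newBalls]
  | succ k ih =>
    have h1 := Finset.sum_nonneg fun j (_ : j ∈ I k) => h.nonneg k j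
    have h2 := Finset.sum_nonneg fun j (_ : j ∈ I k) => ih j
    have h3 := h.nonneg (k + 1) i
    rw [newBalls]
    split_ifs
    · positivity
    · exact ih i

lemma newBalls_le (h : IsFracRun S n b I) : ∀ k ≤ n, ∀ i, newBalls b I k i ≤ b k i := by
  intro k
  induction k with
  | zero => exact fun _ i => h.nonneg 0 i
  | succ k ih =>
    intro hk i
    have h1 := Finset.sum_nonneg fun j (_ : j ∈ I k) => h.nonneg k j
    rw [newBalls]
    split_ifs with hi
    · refine mul_le_of_le_one_right (h.nonneg _ _) ((div_le_one (by linarith)).2 ?_)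
      gcongr with j
      exact ih (by omega) j
    · rw [h.eq_of_notMem k (by omega) i hi]
      exact ih (by omega) i

lemma isFracRun_newBalls (h : IsFracRun S n b I) : IsFracRun S n (newBalls b I) I := by
  refine ⟨h.newBalls_nonneg, h.subset, fun k _ i hi => by rw [newBalls, if_neg hi],
    fun k hk => ?_⟩
  have h1 := Finset.sum_nonneg fun j (_ : j ∈ I k) => h.nonneg k j
  rw [Finset.sum_congr rfl fun i hi => by rw [newBalls, if_pos hi], ← Finset.sum_mul,
    h.sum_succ k hk, mul_div_cancel₀]
  linarith

/-- If every bin of `S` is shuffled at some point, then all balls initially in `S` are moved. -/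
lemma fracCost_newBalls_add_le (h : IsFracRun S n b I) (hI : ∀ i ∈ S, ∃ k < n, i ∈ I k) :
    fracCost n (newBalls b I) I + ∑ i ∈ S, b 0 i ≤ fracCost n b I := by
  set e : ℕ → ι → ℝ := fun k i => b k i - newBalls b I k i with he
  have he0 : ∀ k < n, ∀ i, 0 ≤ e k i := fun k hk i => sub_nonneg.2 (h.newBalls_le k hk.le i)
  have hsum : fracCost n b I - fracCost n (newBalls b I) I
      = ∑ k ∈ Finset.range n, ∑ i ∈ I k, e k i := by
    simp only [fracCost, he, Finset.sum_sub_distrib, Finset.sum_add_distrib]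
    ring
  have hswap : ∑ k ∈ Finset.range n, ∑ i ∈ I k, e k i
      = ∑ i ∈ S, ∑ k ∈ Finset.range n, if i ∈ I k then e k i else 0 := by
    rw [Finset.sum_comm]
    refine Finset.sum_congr rfl fun k hk => ?_
    rw [← Finset.sum_filter, Finset.filter_mem_eq_inter,
      Finset.inter_eq_right.2 (h.subset k (Finset.mem_range.1 hk))]
  have hle : ∑ i ∈ S, b 0 i ≤ ∑ i ∈ S, ∑ k ∈ Finset.range n, if i ∈ I k then e k i else 0 := by
    refine Finset.sum_le_sum fun i hi => ?_
    have hex := hI i hi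
    have hspec := Nat.find_spec hex
    have hconst : ∀ k ≤ Nat.find hex, e k i = b 0 i := by
      intro k
      induction k with
      | zero => simp [he, newBalls]
      | succ k ih =>
        intro hk
        have hkn : k < n := by omega
        have hki : i ∉ I k := fun hki => Nat.find_min hex (m := k) (by omega) ⟨hkn, hki⟩
        rw [← ih (by omega)]
        simp only [he]
        rw [h.eq_of_notMem k hkn i hki, newBalls, if_neg hki]
    have hsingle := Finset.single_le_sum (s := Finset.range n)
      (f := fun k => if i ∈ I k then e k i else 0)
      (fun k hk => by
        split_ifs
        · exact he0 k (Finset.mem_range.1 hk) i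
        · exact le_rfl) (Finset.mem_range.2 hspec.1)
    simpa [hspec.2, hconst _ le_rfl] using hsingle
  linarith

lemma le_fracCost {γ l : ℝ} (hγ : 0 ≤ γ)
    (hsplit : ∀ n : ℕ, 1 ≤ n → l * Real.log n - γ ≤ 1 ∨
      ∃ m₁ m₂ : ℕ, 0 < m₁ ∧ 0 < m₂ ∧ m₁ + m₂ = n ∧
        l * (n * Real.log n - m₁ * Real.log m₁ - m₂ * Real.log m₂) ≤ m₁ ∧
        l * (n * Real.log n - m₁ * Real.log m₁ - m₂ * Real.log m₂) ≤ γ * m₂)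
    (h : IsFracRun S n b I) :
    n * (l * Real.log n - γ * S.card) ≤ fracCost n b I := by
  induction n using Nat.strong_induction_on generalizing S b I with
  | _ n ih =>
  rcases Nat.eq_zero_or_pos n with rfl | hn
  · simp [fracCost]
  have hS : S.Nonempty := by
    by_contra hS
    rw [Finset.not_nonempty_iff_eq_empty] at hS
    have h1 := h.subset 0 hn
    rw [hS, Finset.subset_empty] at h1
    simpa [h1] using h.sum_succ 0 hn
  have hcard : (1 : ℝ) ≤ S.card := by exact_mod_cast hS.card_pos
  rcases hsplit n hn with hsmall | ⟨m₁, m₂, hm₁, hm₂, rfl, hold, hnew⟩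
  · refine le_trans ?_ h.natCast_le_fracCost
    refine mul_le_of_le_one_right (Nat.cast_nonneg n) ?_
    nlinarith
  have hcost : fracCost (m₁ + m₂) b I
      = fracCost m₁ b I + fracCost m₂ (fun k => b (m₁ + k)) (fun k => I (m₁ + k)) := by
    simp only [fracCost, Finset.sum_range_add]
  have hfst := ih m₁ (by omega) (h.mono (Nat.le_add_right _ _))
  have hrun := h.shift
  rw [hcost]
  push_cast at hold hnew ⊢
  by_cases hI : ∀ i ∈ S, ∃ k < m₂, i ∈ I (m₁ + k)
  · have h1 := hrun.fracCost_newBalls_add_le hI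
    have h2 := ih m₂ (by omega) hrun.isFracRun_newBalls
    have h3 := h.natCast_le_sum m₁ (by omega)
    simp only [Nat.add_zero] at h1
    linarith
  · push Not at hI
    obtain ⟨j, hj, hjI⟩ := hI
    have hrun' : IsFracRun (S.erase j) m₂ (fun k => b (m₁ + k)) (fun k => I (m₁ + k)) :=
      ⟨hrun.nonneg, fun k hk => Finset.subset_erase.2 ⟨hrun.subset k hk, hjI k hk⟩,
        hrun.eq_of_notMem, hrun.sum_succ⟩
    have h2 := ih m₂ (by omega) hrun'
    rw [Finset.cast_card_erase_of_mem hj] at h2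
    linarith

end IsFracRun

end FractionalRuns

lemma le_shuffleCost {t n : ℕ} {x : ℝ}
    (hx : ∀ b I, IsFracRun (Finset.univ : Finset (Fin t)) n b I → x ≤ fracCost n b I)
    (ht : 1 ≤ t) : x ≤ shuffleCost t n := by
  have hne : {s | ∃ b c, IsRun t n b c ∧ s = ∑ k ∈ Finset.range n, c k}.Nonempty := by
    have ht0 : NeZero t := ⟨by omega⟩
    refine ⟨_, fun k i => if i = 0 then k else 0, fun k => k + 1, ⟨by simp, fun k _ => ?_⟩, rfl⟩
    exact ⟨Finset.univ, by simp, by simp, by simp⟩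
  obtain ⟨b, c, ⟨-, hstep⟩, hs⟩ := Nat.sInf_mem hne
  rw [shuffleCost, hs]
  choose! I hc hI hsum using hstep
  set J : ℕ → Finset (Fin t) := fun k => I k ∪ Finset.univ.filter fun i => b k i = 0 with hJ
  have hJsum : ∀ k, ∑ i ∈ J k, b k i = ∑ i ∈ I k, b k i := fun k =>
    (Finset.sum_subset Finset.subset_union_left fun i hi hi' => by
      simpa [hJ, hi'] using hi).symm
  have hJeq : ∀ k < n, ∀ i ∉ J k, b (k + 1) i = b k i := fun k hk i hi => by
    simp only [hJ, Finset.mem_union, Finset.mem_filter, Finset.mem_univ, true_and, not_or] at hi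
    exact hI k hk i hi.1 hi.2
  have hrun : IsFracRun (Finset.univ : Finset (Fin t)) n (fun k i => (b k i : ℝ)) J := by
    refine ⟨fun k i => Nat.cast_nonneg _, fun k _ => Finset.subset_univ _,
      fun k hk i hi => by exact_mod_cast hJeq k hk i hi, fun k hk => ?_⟩
    have h1 := hsum k hk
    have h2 : ∑ i ∈ (J k)ᶜ, b (k + 1) i = ∑ i ∈ (J k)ᶜ, b k i :=
      Finset.sum_congr rfl fun i hi => hJeq k hk i (Finset.mem_compl.1 hi)
    rw [← Finset.sum_add_sum_compl (J k), ← Finset.sum_add_sum_compl (J k) (b k)] at h1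
    have h3 : ∑ i ∈ J k, b (k + 1) i = ∑ i ∈ J k, b k i + 1 := by omega
    exact_mod_cast h3
  refine (hx _ _ hrun).trans (le_of_eq ?_)
  rw [fracCost, Nat.cast_sum]
  refine Finset.sum_congr rfl fun k hk => ?_
  rw [hc k (Finset.mem_range.1 hk), ← hJsum]
  push_cast
  rfl

lemma entropy_le {K n m m' : ℕ} (hm : 0 < m) (hm' : 0 < m') (hmn : m + m' = n)
    (hn : n ≤ 2 * (K + 1) * m) :
    (n : ℝ) * Real.log n - m * Real.log m - m' * Real.log m'
      ≤ m * (1 + Real.log (2 * (K + 1))) := by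
  have hm0 : (0 : ℝ) < m := by exact_mod_cast hm
  have hm0' : (0 : ℝ) < m' := by exact_mod_cast hm'
  have hmnR : (n : ℝ) = m + m' := by exact_mod_cast hmn.symm
  have hn0 : (0 : ℝ) < n := by linarith
  have hnR : (n : ℝ) ≤ 2 * (K + 1) * m := by exact_mod_cast hn
  have h1 : Real.log n - Real.log m ≤ Real.log (2 * (K + 1)) := by
    rw [← Real.log_div hn0.ne' hm0.ne']
    exact Real.log_le_log (by positivity) ((div_le_iff₀ hm0).2 hnR)
  have h2 : m' * (Real.log n - Real.log m') ≤ m := by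
    rw [← Real.log_div hn0.ne' hm0'.ne']
    calc m' * Real.log (n / m') ≤ m' * (n / m' - 1) := by
          gcongr
          exact Real.log_le_sub_one_of_pos (by positivity)
      _ = m := by field_simp; linarith
  have h3 := mul_le_mul_of_nonneg_left h1 hm0.le
  have h4 : (n : ℝ) * Real.log n = m * Real.log n + m' * Real.log n := by rw [hmnR]; ring
  linarith

lemma exists_split {K n : ℕ} (hK : 1 ≤ K) (hn : K < n) :
    ∃ m m' : ℕ, 0 < m ∧ 0 < m' ∧ m + m' = n ∧ K * m ≤ m' ∧ n ≤ 2 * (K + 1) * m := by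
  have h1 : 1 ≤ n / (K + 1) := (Nat.one_le_div_iff (by omega)).2 hn
  have h2 := Nat.div_add_mod n (K + 1)
  have h3 := Nat.mod_lt n (show 0 < K + 1 by omega)
  generalize n / (K + 1) = m at *
  refine ⟨m, n - m, h1, ?_, ?_, ?_, ?_⟩
  · have : 1 * m ≤ K * m := Nat.mul_le_mul_right m hK
    have : (K + 1) * m = K * m + m := by ring
    omega
  · have : (K + 1) * m = K * m + m := by ring
    omega
  · have : (K + 1) * m = K * m + m := by ring
    omega
  · nlinarith

lemma one_lt_one_add_log (K : ℕ) : 1 < 1 + Real.log (2 * ((K : ℝ) + 1)) := by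
  have : 0 < Real.log (2 * ((K : ℝ) + 1)) :=
    Real.log_pos (by have := Nat.cast_nonneg (α := ℝ) K; linarith)
  linarith

lemma log_div_le_one {K n : ℕ} (hn : 1 ≤ n) (hK : n ≤ K) :
    Real.log n / (1 + Real.log (2 * ((K : ℝ) + 1))) ≤ 1 := by
  have h0 := one_lt_one_add_log K
  have hn0 : (0 : ℝ) < n := by exact_mod_cast hn
  have hKR : (n : ℝ) ≤ K := by exact_mod_cast hK
  have := Real.log_le_log hn0 (show (n : ℝ) ≤ 2 * ((K : ℝ) + 1) by linarith)
  rw [div_le_one (by linarith)]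
  linarith

/-- The lower bound that is effective when `t` is small compared to `log n`. -/
lemma le_shuffleCost_of_few_bins {K : ℕ} (hK : 1 ≤ K) {t : ℕ} (ht : 1 ≤ t) (n : ℕ) :
    n * (K / (1 + Real.log (2 * ((K : ℝ) + 1))) * Real.log n - K * t) ≤ shuffleCost t n := by
  refine le_shuffleCost (fun b I h => ?_) ht
  have h0 := one_lt_one_add_log K
  have key := h.le_fracCost (γ := K) (l := K / (1 + Real.log (2 * ((K : ℝ) + 1))))
    (Nat.cast_nonneg K) fun n hn => ?_
  · simpa using key
  rcases le_or_gt n K with hnK | hnK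
  · left
    have := mul_le_mul_of_nonneg_left (log_div_le_one hn hnK) (Nat.cast_nonneg (α := ℝ) K)
    rw [div_mul_eq_mul_div, mul_div_assoc]
    linarith
  · right
    obtain ⟨m, m', hm, hm', hmn, hle, hn2⟩ := exists_split hK hnK
    have hent := entropy_le hm hm' hmn hn2
    have hleR : (K : ℝ) * m ≤ m' := by exact_mod_cast hle
    have hbound : K / (1 + Real.log (2 * ((K : ℝ) + 1))) *
        (n * Real.log n - m' * Real.log m' - m * Real.log m) ≤ K * m := by
      rw [div_mul_eq_mul_div, div_le_iff₀ (by linarith), mul_assoc]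
      gcongr
      linarith
    exact ⟨m', m, hm', hm, by omega, hbound.trans hleR, hbound⟩

/-- The lower bound that is effective when `t` is comparable to `log n`. -/
lemma le_shuffleCost_of_many_bins {K : ℕ} (hK : 1 ≤ K) {t : ℕ} (ht : 1 ≤ t) (n : ℕ) :
    n * (Real.log n / (1 + Real.log (2 * ((K : ℝ) + 1))) - t / K) ≤ shuffleCost t n := by
  refine le_shuffleCost (fun b I h => ?_) ht
  have h0 := one_lt_one_add_log K
  have hK0 : (0 : ℝ) < K := by exact_mod_cast hK
  have key := h.le_fracCost (γ := (K : ℝ)⁻¹) (l := (1 + Real.log (2 * ((K : ℝ) + 1)))⁻¹)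
    (by positivity) fun n hn => ?_
  · simpa [div_eq_inv_mul] using key
  rcases le_or_gt n K with hnK | hnK
  · left
    have h1 := log_div_le_one hn hnK
    have h2 : 0 < (K : ℝ)⁻¹ := by positivity
    rw [inv_mul_eq_div]
    linarith
  · right
    obtain ⟨m, m', hm, hm', hmn, hle, hn2⟩ := exists_split hK hnK
    have hent := entropy_le hm hm' hmn hn2
    have hleR : (K : ℝ) * m ≤ m' := by exact_mod_cast hle
    have hbound : (1 + Real.log (2 * ((K : ℝ) + 1)))⁻¹ *
        (n * Real.log n - m * Real.log m - m' * Real.log m') ≤ m := by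
      rw [inv_mul_le_iff₀ (by linarith)]
      linarith
    refine ⟨m, m', hm, hm', hmn, hbound, hbound.trans ?_⟩
    rw [inv_mul_eq_div, le_div_iff₀ hK0]
    linarith

lemma exists_mul_one_add_log_le {α : ℝ} (hα : 0 < α) :
    ∃ K : ℕ, 1 ≤ K ∧ 2 * α * (1 + Real.log (2 * ((K : ℝ) + 1))) ≤ K := by
  have hlim : Filter.Tendsto (fun K : ℕ => 2 * ((K : ℝ) + 1)) Filter.atTop Filter.atTop :=
    (Filter.tendsto_atTop_add_const_right _ _ tendsto_natCast_atTop_atTop).const_mul_atTop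
      two_pos
  have hlog := hlim.eventually
    (Real.isLittleO_log_id_atTop.bound (show 0 < 1 / (8 * α) by positivity))
  obtain ⟨K, hK, hK1, hKα⟩ := (hlog.and ((Filter.eventually_ge_atTop 1).and
    (tendsto_natCast_atTop_atTop.eventually_ge_atTop (4 * α + 1)))).exists
  refine ⟨K, hK1, ?_⟩
  rw [id, Real.norm_of_nonneg (show (0 : ℝ) ≤ 2 * (K + 1) by positivity)] at hK
  calc 2 * α * (1 + Real.log (2 * ((K : ℝ) + 1)))
      ≤ 2 * α * (1 + 1 / (8 * α) * (2 * ((K : ℝ) + 1))) := by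
        gcongr
        exact (le_abs_self _).trans hK
    _ = 2 * α + (K + 1) / 2 := by field_simp; ring
    _ ≤ K := by linarith

/-- Part (ii) of the ball-shuffling lower bound: for every constant α > 0 there
exist constants c > 0 and ε > 0 such that for all integers n ≥ 2 and all integers
t with 1 ≤ t < α·ln n, we have f_t(n) ≥ c·t·n^{1+ε/t}. -/
theorem ball_shuffling_lower_bound_part_ii (α : ℝ) (hα : 0 < α) :
    ∃ c ε : ℝ, 0 < c ∧ 0 < ε ∧
      ∀ n t : ℕ, 2 ≤ n → 1 ≤ t → (t : ℝ) < α * Real.log n →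
        (shuffleCost t n : ℝ) ≥ c * (t : ℝ) * (n : ℝ) ^ (1 + ε / (t : ℝ)) := by
  obtain ⟨K, hK, hKα⟩ := exists_mul_one_add_log_le hα
  have hL := one_lt_one_add_log K
  set L := 1 + Real.log (2 * ((K : ℝ) + 1)) with hLdef
  have hK0 : (0 : ℝ) < K := by exact_mod_cast hK
  refine ⟨min (1 / 2) (1 / (2 * α * L) * Real.exp (-(5 / 2))), 1 / 4, by positivity, by norm_num,
    fun n t hn ht htα => ?_⟩
  have ht0 : (0 : ℝ) < t := by exact_mod_cast ht
  have hn0 : (0 : ℝ) < n := by exact_mod_cast (by omega : 0 < n)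
  set u := Real.log n / t with hu
  have hlog : Real.log n = t * u := by rw [hu]; field_simp
  have hpow : (n : ℝ) ^ (1 + 1 / 4 / (t : ℝ)) = n * Real.exp (u / 4) := by
    rw [Real.rpow_add hn0, Real.rpow_one, Real.rpow_def_of_pos hn0, hu]
    congr 2
    field_simp
  rw [hpow, ge_iff_le]
  rcases le_total u 10 with hu10 | hu10
  · have hcost := le_shuffleCost_of_many_bins hK ht n
    rw [← hLdef] at hcost
    have h1 : (t : ℝ) / K ≤ t / (2 * α * L) := by gcongr
    have h2 : t / (2 * α * L) * 2 ≤ Real.log n / L := by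
      rw [le_div_iff₀ (by linarith)]
      calc t / (2 * α * L) * 2 * L = t / α := by field_simp
        _ ≤ Real.log n := by rw [div_le_iff₀ hα]; linarith
    have h3 : Real.exp (-(5 / 2)) * Real.exp (u / 4) ≤ 1 := by
      rw [← Real.exp_add, Real.exp_le_one_iff]
      linarith
    calc _ ≤ 1 / (2 * α * L) * Real.exp (-(5 / 2)) * t * (n * Real.exp (u / 4)) := by
          gcongr
          exact min_le_right _ _
      _ = n * (t / (2 * α * L)) * (Real.exp (-(5 / 2)) * Real.exp (u / 4)) := by ring
      _ ≤ n * (t / (2 * α * L)) * 1 := by gcongr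
      _ ≤ n * (Real.log n / L - t / K) := by
          rw [mul_one]
          gcongr
          linarith
      _ ≤ _ := hcost
  · have hexp1 : 1 ≤ Real.exp (u / 4) := Real.one_le_exp (by linarith)
    set M := ⌊Real.exp (u / 4)⌋₊ with hM
    have hM1 : 1 ≤ M := Nat.one_le_floor_iff _ |>.2 hexp1
    have hMle : (M : ℝ) ≤ Real.exp (u / 4) := Nat.floor_le (by positivity)
    have hMlt : Real.exp (u / 4) < M + 1 := Nat.lt_floor_add_one _
    have hM1R : (1 : ℝ) ≤ M := by exact_mod_cast hM1
    have hcost := le_shuffleCost_of_few_bins hM1 ht n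
    have hLM := one_lt_one_add_log M
    have hLM2 : 1 + Real.log (2 * ((M : ℝ) + 1)) ≤ u / 2 := by
      have h1 : Real.log (2 * ((M : ℝ) + 1)) ≤ Real.log (4 * Real.exp (u / 4)) :=
        Real.log_le_log (by positivity) (by linarith)
      have h4 : Real.log 4 = 2 * Real.log 2 := by
        rw [show (4 : ℝ) = 2 ^ 2 by norm_num, Real.log_pow]; norm_num
      rw [Real.log_mul (by norm_num) (Real.exp_pos _).ne', Real.log_exp, h4] at h1
      linarith [Real.log_two_lt_d9]
    have h5 : M * t * 2 ≤ M / (1 + Real.log (2 * ((M : ℝ) + 1))) * Real.log n := by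
      rw [div_mul_eq_mul_div, le_div_iff₀ (by linarith), hlog]
      calc (M : ℝ) * t * 2 * (1 + Real.log (2 * ((M : ℝ) + 1))) ≤ M * t * 2 * (u / 2) := by
            gcongr
        _ = M * (t * u) := by ring
    calc _ ≤ 1 / 2 * (t : ℝ) * (n * Real.exp (u / 4)) := by
          gcongr
          exact min_le_left _ _
      _ = n * (Real.exp (u / 4) / 2 * t) := by ring
      _ ≤ n * (M * t) := by
          gcongr
          linarith
      _ ≤ n * (M / (1 + Real.log (2 * ((M : ℝ) + 1))) * Real.log n - M * t) := by
          gcongr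
          linarith
      _ ≤ _ := hcost
end

section
/- Merging lemma: for all integers n ≥ 1 and t ≥ 1, there exists an algorithm for the ball-shuffling problem with n balls and t bins that uses only merging shuffles and whose total cost equals the optimal cost f_t(n). -/
/-- A merging shuffle: a set I of bins is emptied and all the collected balls,
together with the new ball, are placed into a single bin j (which must be
empty after the collection, i.e. j is in I or j was empty). -/
def MergingStep (t : ℕ) (b b' : Fin t → ℕ) (c : ℕ) : Prop :=
  ∃ (I : Finset (Fin t)) (j : Fin t),
    c = (∑ i ∈ I, b i) + 1 ∧
    (j ∈ I ∨ b j = 0) ∧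
    b' j = (∑ i ∈ I, b i) + 1 ∧
    (∀ i ∈ I, i ≠ j → b' i = 0) ∧
    (∀ i, i ∉ I → i ≠ j → b' i = b i)

/-- A run that uses only merging shuffles. -/
def IsMergingRun (t n : ℕ) (b : ℕ → Fin t → ℕ) (c : ℕ → ℕ) : Prop :=
  (∀ i, b 0 i = 0) ∧ ∀ k, k < n → MergingStep t (b k) (b (k + 1)) (c k)

/-- The configurations obtained by emptying, in step `k`, the bins in `J k` and putting all
collected balls together with the new one into bin `j k`. -/
def mergeConfig {t : ℕ} (J : ℕ → Finset (Fin t)) (j : ℕ → Fin t) : ℕ → Fin t → ℕ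
  | 0 => fun _ => 0
  | k + 1 => fun i =>
      if i = j k then (∑ x ∈ J k, mergeConfig J j k x) + 1
      else if i ∈ J k then 0 else mergeConfig J j k i

theorem mergeConfig_isMergingRun {t n : ℕ} (J : ℕ → Finset (Fin t)) (j : ℕ → Fin t)
    (hj : ∀ k < n, j k ∈ J k) :
    IsMergingRun t n (mergeConfig J j) (fun k => (∑ i ∈ J k, mergeConfig J j k i) + 1) := by
  refine ⟨fun i => rfl, fun k hk => ⟨J k, j k, rfl, Or.inl (hj k hk), ?_, ?_, ?_⟩⟩
  · simp [mergeConfig]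
  · intro i hi hij
    simp [mergeConfig, hi, hij]
  · intro i hi hij
    simp [mergeConfig, hi, hij]

theorem MergingStep.shuffleStep {t : ℕ} {b b' : Fin t → ℕ} {c : ℕ} (h : MergingStep t b b' c) :
    ShuffleStep t b b' c := by
  obtain ⟨I, j, hc, hj, hbj, hI, hout⟩ := h
  refine ⟨I, hc, fun i hi hne => hout i hi ?_, ?_⟩
  · rintro rfl
    exact hj.elim hi hne
  · have hsum : ∑ i ∈ insert j I, b i = ∑ i ∈ I, b i :=
      Finset.sum_insert_of_eq_zero_if_notMem fun h => hj.resolve_left h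
    have hsum' : ∑ i ∈ insert j I, b' i = b' j :=
      Finset.sum_eq_single_of_mem j (Finset.mem_insert_self j I) fun i hi hij =>
        hI i ((Finset.mem_insert.1 hi).resolve_left hij) hij
    have hcompl : ∑ i ∈ (insert j I)ᶜ, b' i = ∑ i ∈ (insert j I)ᶜ, b i := by
      refine Finset.sum_congr rfl fun i hi => ?_
      simp only [Finset.mem_compl, Finset.mem_insert, not_or] at hi
      exact hout i hi.2 hi.1
    have h₁ := Finset.sum_add_sum_compl (insert j I) b
    have h₂ := Finset.sum_add_sum_compl (insert j I) b'
    omega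

theorem IsMergingRun.isRun {t n : ℕ} {b : ℕ → Fin t → ℕ} {c : ℕ → ℕ}
    (h : IsMergingRun t n b c) : IsRun t n b c :=
  ⟨h.1, fun k hk => (h.2 k hk).shuffleStep⟩

/-- The bins in `J k` being emptied in step `k`, there are target bins `j k` and numbers `h k i`
counting the moves still to come for a ball lying in bin `i` before step `k`, when every moved ball
is always put into the target bin, which minimizes this number. -/
theorem exists_optimal_targets {t : ℕ} (ht : 1 ≤ t) (n : ℕ) (J : ℕ → Finset (Fin t))
    (hJ : ∀ k < n, (J k).Nonempty) :
    ∃ (h : ℕ → Fin t → ℕ) (j : ℕ → Fin t), (∀ i, h n i = 0) ∧ ∀ k < n, j k ∈ J k ∧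
      (∀ i ∈ J k, h k i = h (k + 1) (j k) + 1) ∧ (∀ i ∉ J k, h k i = h (k + 1) i) ∧
      ∀ i ∈ J k, h (k + 1) (j k) ≤ h (k + 1) i := by
  induction n generalizing J with
  | zero => exact ⟨fun _ _ => 0, fun _ => ⟨0, ht⟩, by simp⟩
  | succ n ih =>
    obtain ⟨h, j, hn, hh⟩ := ih (fun k => J (k + 1)) fun k hk => hJ (k + 1) (by omega)
    obtain ⟨j₀, hj₀, hmin⟩ := (J 0).exists_min_image (h 0) (hJ 0 (by omega))
    refine ⟨fun k => k.casesOn (fun i => if i ∈ J 0 then h 0 j₀ + 1 else h 0 i) h,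
      fun k => k.casesOn j₀ j, hn, fun k hk => ?_⟩
    cases k with
    | zero => exact ⟨hj₀, fun i hi => if_pos hi, fun i hi => if_neg hi, hmin⟩
    | succ k => exact hh k (by omega)

theorem sum_mul_potential {t : ℕ} {J : Finset (Fin t)} {h h' : Fin t → ℕ} {m : ℕ}
    (hmem : ∀ i ∈ J, h i = m + 1) (hout : ∀ i ∉ J, h i = h' i) (b : Fin t → ℕ) :
    ∑ i, b i * h i = (∑ i ∈ J, b i) * (m + 1) + ∑ i ∈ Jᶜ, b i * h' i := by
  rw [← Finset.sum_add_sum_compl J, Finset.sum_mul]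
  congr 1
  · exact Finset.sum_congr rfl fun i hi => by rw [hmem i hi]
  · exact Finset.sum_congr rfl fun i hi => by rw [hout i (Finset.mem_compl.1 hi)]

/-- Adding the empty bins to the set of emptied bins of a shuffle, all other bins are unchanged. -/
theorem ShuffleStep.exists_changed_bins {t : ℕ} {b b' : Fin t → ℕ} {c : ℕ}
    (h : ShuffleStep t b b' c) :
    ∃ J : Finset (Fin t), c = (∑ i ∈ J, b i) + 1 ∧ (∀ i ∉ J, b' i = b i) ∧
      ∑ i ∈ J, b' i = (∑ i ∈ J, b i) + 1 := by
  obtain ⟨I, hc, hkeep, hsum⟩ := h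
  have hI : ∑ i ∈ I ∪ Finset.univ.filter (fun i => b i = 0), b i = ∑ i ∈ I, b i := by
    refine (Finset.sum_subset Finset.subset_union_left fun i hi hiI => ?_).symm
    simpa [hiI] using hi
  have hJ : ∀ i ∉ I ∪ Finset.univ.filter (fun i => b i = 0), b' i = b i := by
    intro i hi
    simp only [Finset.mem_union, Finset.mem_filter, Finset.mem_univ, true_and, not_or] at hi
    exact hkeep i hi.1 hi.2
  refine ⟨_, hc.trans (by rw [hI]), hJ, ?_⟩
  generalize I ∪ Finset.univ.filter (fun i => b i = 0) = J at hJ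
  have h₁ := Finset.sum_add_sum_compl J b
  have h₂ := Finset.sum_add_sum_compl J b'
  have h₃ : ∑ i ∈ Jᶜ, b' i = ∑ i ∈ Jᶜ, b i :=
    Finset.sum_congr rfl fun i hi => hJ i (Finset.mem_compl.1 hi)
  omega

/-- Any run can be replaced by a merging run that is at most as expensive. -/
theorem IsRun.exists_isMergingRun_le {t n : ℕ} (ht : 1 ≤ t) {b : ℕ → Fin t → ℕ} {c : ℕ → ℕ}
    (hrun : IsRun t n b c) :
    ∃ (b' : ℕ → Fin t → ℕ) (c' : ℕ → ℕ), IsMergingRun t n b' c' ∧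
      ∑ k ∈ Finset.range n, c' k ≤ ∑ k ∈ Finset.range n, c k := by
  have hstep : ∀ k, ∃ J : Finset (Fin t), k < n → c k = (∑ i ∈ J, b k i) + 1 ∧
      (∀ i ∉ J, b (k + 1) i = b k i) ∧ ∑ i ∈ J, b (k + 1) i = (∑ i ∈ J, b k i) + 1 := by
    intro k
    by_cases hk : k < n
    · obtain ⟨J, hJ⟩ := (hrun.2 k hk).exists_changed_bins
      exact ⟨J, fun _ => hJ⟩
    · exact ⟨∅, fun h => absurd h hk⟩
  choose J hJ using hstep
  have hne : ∀ k < n, (J k).Nonempty := by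
    intro k hk
    rw [Finset.nonempty_iff_ne_empty]
    intro h
    simpa [h] using (hJ k hk).2.2
  obtain ⟨h, j, hn, hh⟩ := exists_optimal_targets ht n J hne
  refine ⟨_, _, mergeConfig_isMergingRun J j fun k hk => (hh k hk).1, ?_⟩
  set b' := mergeConfig J j with hb'
  have lower : ∀ k ≤ n, ∑ l ∈ Finset.range k, (h (l + 1) (j l) + 1) ≤
      ∑ l ∈ Finset.range k, c l + ∑ i, b k i * h k i := by
    intro k
    induction k with
    | zero => simp
    | succ k ih =>
      intro hk
      obtain ⟨-, hmem, hout, hmin⟩ := hh k hk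
      obtain ⟨hc, hkeep, hsum⟩ := hJ k hk
      have hpot := sum_mul_potential hmem hout (b k)
      have hsplit := Finset.sum_add_sum_compl (J k) fun i => b (k + 1) i * h (k + 1) i
      have hcompl : ∑ i ∈ (J k)ᶜ, b (k + 1) i * h (k + 1) i =
          ∑ i ∈ (J k)ᶜ, b k i * h (k + 1) i :=
        Finset.sum_congr rfl fun i hi => by rw [hkeep i (Finset.mem_compl.1 hi)]
      have hle : (∑ i ∈ J k, b (k + 1) i) * h (k + 1) (j k) ≤
          ∑ i ∈ J k, b (k + 1) i * h (k + 1) i := by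
        rw [Finset.sum_mul]
        exact Finset.sum_le_sum fun i hi => Nat.mul_le_mul_left _ (hmin i hi)
      rw [hsum] at hle
      rw [Finset.sum_range_succ, Finset.sum_range_succ]
      have := ih (by omega)
      linarith
  have upper : ∀ k ≤ n, ∑ l ∈ Finset.range k, ((∑ i ∈ J l, b' l i) + 1) + ∑ i, b' k i * h k i =
      ∑ l ∈ Finset.range k, (h (l + 1) (j l) + 1) := by
    intro k
    induction k with
    | zero => simp [hb', mergeConfig]
    | succ k ih =>
      intro hk
      obtain ⟨hjk, hmem, hout, -⟩ := hh k hk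
      have hpot := sum_mul_potential hmem hout (b' k)
      have hsplit := Finset.sum_add_sum_compl (J k) fun i => b' (k + 1) i * h (k + 1) i
      have hcompl : ∑ i ∈ (J k)ᶜ, b' (k + 1) i * h (k + 1) i =
          ∑ i ∈ (J k)ᶜ, b' k i * h (k + 1) i := by
        refine Finset.sum_congr rfl fun i hi => ?_
        have hi := Finset.mem_compl.1 hi
        have hij : i ≠ j k := fun e => hi (e ▸ hjk)
        simp [hb', mergeConfig, hi, hij]
      have heq : ∑ i ∈ J k, b' (k + 1) i * h (k + 1) i =
          ((∑ i ∈ J k, b' k i) + 1) * h (k + 1) (j k) := by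
        rw [Finset.sum_eq_single_of_mem (j k) hjk]
        · simp [hb', mergeConfig]
        · intro i hi hij
          simp [hb', mergeConfig, hi, hij]
      rw [Finset.sum_range_succ, Finset.sum_range_succ]
      have := ih (by omega)
      linarith
  have h₁ := lower n le_rfl
  have h₂ := upper n le_rfl
  simp only [hn, mul_zero, Finset.sum_const_zero, add_zero] at h₁ h₂
  exact h₂.trans_le h₁

/-- Merging lemma: for all n ≥ 1 and t ≥ 1, there is an algorithm for the
ball-shuffling problem with n balls and t bins that uses only merging shuffles
and whose total cost equals the optimal cost f_t(n). -/
theorem merging_lemma (n t : ℕ) (hn : 1 ≤ n) (ht : 1 ≤ t) :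
    ∃ (b : ℕ → Fin t → ℕ) (c : ℕ → ℕ),
      IsMergingRun t n b c ∧ (∑ k ∈ Finset.range n, c k) = shuffleCost t n := by
  have hne : {s | ∃ b c, IsRun t n b c ∧ s = ∑ k ∈ Finset.range n, c k}.Nonempty :=
    ⟨_, _, _, (mergeConfig_isMergingRun (fun _ => Finset.univ) (fun _ => (⟨0, ht⟩ : Fin t))
      fun _ _ => Finset.mem_univ _).isRun, rfl⟩
  obtain ⟨b, c, hrun, hcost⟩ := Nat.sInf_mem hne
  obtain ⟨b', c', hmerge, hle⟩ := hrun.exists_isMergingRun_le ht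
  exact ⟨b', c', hmerge, le_antisymm (hle.trans_eq hcost.symm)
    (Nat.sInf_le ⟨b', c', hmerge.isRun, rfl⟩)⟩
end

section
/- Recurrence for the ball-shuffling cost: for all integers t ≥ 1 and n ≥ 1, f_{t+1}(n) is at least the minimum, over all integers k ≥ 1 and all positive integers x_1, …, x_k with x_1 + ⋯ + x_k = n, of Σ_{i=1}^k f_t(x_i) + Σ_{i=1}^k (k − i + 1 − 1/t)·x_i − 2n. -/
open Finset

/-- `ShuffleReach t b b' n C`: some `n` shuffles of total cost `C` lead from `b` to `b'`. -/
inductive ShuffleReach (t : ℕ) (b : Fin t → ℕ) : (Fin t → ℕ) → ℕ → ℕ → Prop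
  | refl : ShuffleReach t b b 0 0
  | step {b' b'' : Fin t → ℕ} {n C c : ℕ} :
      ShuffleReach t b b' n C → ShuffleStep t b' b'' c → ShuffleReach t b b'' (n + 1) (C + c)

namespace ShuffleReach

variable {t : ℕ} {b b' b'' : Fin t → ℕ} {m n C C' : ℕ}

theorem trans (h : ShuffleReach t b b' m C) (h' : ShuffleReach t b' b'' n C') :
    ShuffleReach t b b'' (m + n) (C + C') := by
  induction h' with
  | refl => exact h
  | step _ hs ih => simpa only [add_assoc] using ih.step hs

theorem sum_eq (h : ShuffleReach t b b' n C) : ∑ i, b' i = ∑ i, b i + n := by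
  induction h with
  | refl => rfl
  | step _ hs ih =>
    obtain ⟨I, -, -, h⟩ := hs
    omega

theorem cons (a : ℕ) (h : ShuffleReach t b b' n C) :
    ShuffleReach (t + 1) (Fin.cons a b) (Fin.cons a b') n C := by
  induction h with
  | refl => exact .refl
  | step _ hs ih =>
    refine ih.step ?_
    obtain ⟨I, hc, hk, hs⟩ := hs
    refine ⟨I.map (Fin.succEmb t), by simpa using hc, fun i => ?_, ?_⟩
    · refine Fin.cases (by simp) (fun j hj hb => ?_) i
      exact hk j (by simpa using hj) hb
    · simp only [Fin.sum_univ_succ, Fin.cons_zero, Fin.cons_succ]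
      omega

theorem exists_isRun (h : ShuffleReach t 0 b n C) :
    ∃ (s : ℕ → Fin t → ℕ) (c : ℕ → ℕ),
      IsRun t n s c ∧ s n = b ∧ C = ∑ k ∈ range n, c k := by
  induction h with
  | refl => exact ⟨fun _ => 0, fun _ => 0, ⟨fun _ => rfl, by simp⟩, rfl, by simp⟩
  | @step b' b'' n C c _ hs ih =>
    obtain ⟨s, d, ⟨h0, hr⟩, rfl, rfl⟩ := ih
    refine ⟨fun k => if k ≤ n then s k else b'', fun k => if k < n then d k else c,
      ⟨by simpa using h0, fun k hk => ?_⟩, by simp, ?_⟩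
    · rcases Nat.lt_succ_iff_lt_or_eq.mp hk with hk | rfl
      · simpa [hk, hk.le, Nat.succ_le_of_lt hk] using hr k hk
      · simpa using hs
    · rw [sum_range_succ]
      simp only [lt_irrefl, if_false]
      congr 1
      exact sum_congr rfl fun k hk => by simp [mem_range.mp hk]

end ShuffleReach

/-- `ShuffleTree t n C`: a merge schedule for `n` balls and `t` bins of cost `C`, in which the
oldest bin is merged with everything for the last time after `m + 1` balls. -/
inductive ShuffleTree : ℕ → ℕ → ℕ → Prop
  | nil (t : ℕ) : ShuffleTree t 0 0
  | node {t m r C C' : ℕ} : ShuffleTree (t + 1) m C → ShuffleTree t r C' →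
      ShuffleTree (t + 1) (m + 1 + r) (C + (m + 1) + C')

theorem ShuffleTree.exists_shuffleReach {t n C : ℕ} (h : ShuffleTree t n C) :
    ∃ b, ShuffleReach t 0 b n C := by
  induction h with
  | nil t => exact ⟨0, .refl⟩
  | @node t m r C C' _ _ ih ih' =>
    obtain ⟨b, hb⟩ := ih
    obtain ⟨b', hb'⟩ := ih'
    have hsum : ∑ i, b i = m := by simpa using hb.sum_eq
    refine ⟨_, (hb.step (b'' := Fin.cons (m + 1) 0) ⟨univ, ?_, by simp, ?_⟩).trans
      (hb'.cons (m + 1))⟩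
    · rw [hsum]
    · simp [Fin.sum_univ_succ (n := t), ← hsum]

theorem shuffleCost_le_of_tree {t n C : ℕ} (h : ShuffleTree t n C) : shuffleCost t n ≤ C := by
  obtain ⟨b, hb⟩ := h.exists_shuffleReach
  obtain ⟨s, c, hr, -, hC⟩ := hb.exists_isRun
  exact Nat.sInf_le ⟨s, c, hr, hC⟩

/-- `PromiseSeq k L`: starting with bins whose contents may still be moved `k i` times, balls can
be inserted one after the other so that the balls are allowed to be moved again `L` times
respectively. -/
inductive PromiseSeq {ι : Type*} : (ι → ℕ) → List ℕ → Prop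
  | nil (k : ι → ℕ) : PromiseSeq k []
  | cons {k k' : ι → ℕ} {L : List ℕ} (D : Set ι) (d : ι) (hd : d ∈ D)
      (hD : ∀ i ∈ D, k' d + 1 ≤ k i) (hK : ∀ i ∉ D, k' i = k i) :
      PromiseSeq k' L → PromiseSeq k (k' d :: L)

theorem exists_promiseSeq_of_steps {t : ℕ} (n : ℕ) (b : ℕ → Fin t → ℕ) (c : ℕ → ℕ)
    (h : ∀ k, k < n → ShuffleStep t (b k) (b (k + 1)) (c k)) :
    ∃ (k : Fin t → ℕ) (L : List ℕ), PromiseSeq k L ∧ L.length = n ∧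
      L.sum + n + ∑ i, k i * b 0 i ≤ ∑ j ∈ range n, c j := by
  induction n generalizing b c with
  | zero => exact ⟨0, [], .nil _, rfl, by simp⟩
  | succ n ih =>
    obtain ⟨k', L, hL, hlen, hle⟩ := ih (fun j => b (j + 1)) (fun j => c (j + 1))
      fun j hj => h (j + 1) (by omega)
    obtain ⟨I, hc, hkeep, hsum⟩ := h 0 (by omega)
    simp only [zero_add] at hle hkeep hsum
    let D : Finset (Fin t) := univ.filter fun i => i ∈ I ∨ b 0 i = 0
    have hkeep' : ∀ i ∉ D, b 1 i = b 0 i := fun i hi => by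
      simp only [D, mem_filter, mem_univ, true_and, not_or] at hi
      exact hkeep i hi.1 hi.2
    have hne : D.Nonempty := by
      by_contra hD
      rw [not_nonempty_iff_eq_empty] at hD
      have : ∑ i, b 1 i = ∑ i, b 0 i := sum_congr rfl fun i _ => hkeep' i (by simp [hD])
      omega
    obtain ⟨d, hd, hmin⟩ := exists_min_image D k' hne
    refine ⟨fun i => if i ∈ D then k' d + 1 else k' i, k' d :: L,
      .cons (D : Set (Fin t)) d hd (fun i hi => ?_) (fun i hi => ?_) hL, by simp [hlen], ?_⟩
    · simp [mem_coe.mp hi]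
    · simp [show i ∉ D from hi]
    · have hID : ∑ i ∈ D, b 0 i = ∑ i ∈ I, b 0 i := by
        symm
        refine sum_subset (fun i hi => by simp [D, hi]) fun i hi hiI => ?_
        simpa [D, hiI] using hi
      have hsplit (f : Fin t → ℕ) : ∑ i, f i = ∑ i ∈ D, f i + ∑ i ∈ Dᶜ, f i :=
        (sum_add_sum_compl D f).symm
      have hKsum : ∑ i ∈ Dᶜ, b 1 i = ∑ i ∈ Dᶜ, b 0 i :=
        sum_congr rfl fun i hi => hkeep' i (by simpa using hi)
      have hKw : ∑ i ∈ Dᶜ, k' i * b 1 i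
          = ∑ i ∈ Dᶜ, (if i ∈ D then k' d + 1 else k' i) * b 0 i :=
        sum_congr rfl fun i hi => by
          have hi : i ∉ D := by simpa using hi
          rw [hkeep' i hi, if_neg hi]
      have hDw : ∑ i ∈ D, (if i ∈ D then k' d + 1 else k' i) * b 0 i
          = (k' d + 1) * ∑ i ∈ D, b 0 i := by
        rw [mul_sum]
        exact sum_congr rfl fun i hi => by rw [if_pos hi]
      have hDw' : k' d * ∑ i ∈ D, b 1 i ≤ ∑ i ∈ D, k' i * b 1 i := by
        rw [mul_sum]
        exact sum_le_sum fun i hi => Nat.mul_le_mul_right _ (hmin i hi)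
      have hDsum : ∑ i ∈ D, b 1 i = ∑ i ∈ D, b 0 i + 1 := by
        rw [hsplit (b 1), hsplit (b 0)] at hsum
        omega
      rw [hDsum] at hDw'
      rw [hsplit] at hle
      rw [hsplit, hDw, sum_range_succ', hc, ← hID, List.sum_cons, ← hKw]
      linarith

namespace PromiseSeq

variable {ι : Type*} {k : ι → ℕ} {L : List ℕ}

theorem map_pred (h : PromiseSeq k L) (hL : ∀ μ ∈ L, 1 ≤ μ) :
    PromiseSeq (fun i => k i - 1) (L.map (· - 1)) := by
  induction h with
  | nil k => exact .nil _
  | @cons k k' L D d hd hD hK _ ih =>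
    have hpos : 1 ≤ k' d := hL _ List.mem_cons_self
    refine .cons (k' := fun i => k' i - 1) D d hd (fun i hi => ?_) (fun i hi => ?_)
      (ih fun μ hμ => hL μ (List.mem_cons_of_mem _ hμ))
    · have := hD i hi
      omega
    · simp [hK i hi]

variable [Fintype ι]

theorem all_pos_or_split (h : PromiseSeq k L) :
    (∀ μ ∈ L, 1 ≤ μ) ∨ ∃ (L₁ L₂ : List ℕ) (k₂ : ι → ℕ), L = L₁ ++ 0 :: L₂ ∧
      (∀ μ ∈ L₁, 1 ≤ μ) ∧ PromiseSeq k L₁ ∧ PromiseSeq k₂ L₂ ∧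
      #{i | k₂ i ≠ 0} < #{i | k i ≠ 0} := by
  induction h with
  | nil k => simp
  | @cons k k' L D d hd hD hK h' ih =>
    have hsub : univ.filter (fun i => k' i ≠ 0) ⊆ univ.filter (fun i => k i ≠ 0) := fun i hi => by
      simp only [mem_filter, mem_univ, true_and] at hi ⊢
      by_cases hiD : i ∈ D
      · have := hD i hiD
        omega
      · rwa [← hK i hiD]
    rcases Nat.eq_zero_or_pos (k' d) with h0 | hpos
    · refine .inr ⟨[], L, k', by simp [h0], by simp, .nil _, h', card_lt_card ?_⟩
      refine (ssubset_iff_of_subset hsub).mpr ⟨d, ?_, by simp [h0]⟩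
      have := hD d hd
      simp only [mem_filter, mem_univ, true_and]
      omega
    · rcases ih with ih | ⟨L₁, L₂, k₂, rfl, hL₁, h₁, h₂, hlt⟩
      · exact .inl (List.forall_mem_cons.mpr ⟨hpos, ih⟩)
      · exact .inr ⟨k' d :: L₁, L₂, k₂, rfl, List.forall_mem_cons.mpr ⟨hpos, hL₁⟩,
          .cons D d hd hD hK h₁, h₂, hlt.trans_le (card_le_card hsub)⟩

end PromiseSeq

theorem List.sum_map_pred_add_length {L : List ℕ} (hL : ∀ μ ∈ L, 1 ≤ μ) :
    (L.map (· - 1)).sum + L.length = L.sum := by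
  induction L with
  | nil => rfl
  | cons a L ih =>
    rw [List.forall_mem_cons] at hL
    have := ih hL.2
    simp only [List.map_cons, List.sum_cons, List.length_cons]
    omega

theorem PromiseSeq.exists_shuffleTree {ι : Type*} [Fintype ι] {k : ι → ℕ} {L : List ℕ}
    (h : PromiseSeq k L) {t : ℕ} (ht : #{i | k i ≠ 0} ≤ t) :
    ∃ C ≤ L.sum + L.length, ShuffleTree t L.length C := by
  induction hN : L.sum + L.length using Nat.strong_induction_on generalizing k L t with
  | _ N ih =>
    subst hN
    have hpred : #{i | k i - 1 ≠ 0} ≤ t := by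
      refine (card_le_card fun i hi => ?_).trans ht
      simp only [mem_filter, mem_univ, true_and] at hi ⊢
      omega
    rcases h.all_pos_or_split with hpos | ⟨L₁, L₂, k₂, rfl, hL₁, h₁, h₂, hlt⟩
    · rcases eq_or_ne L [] with rfl | hne
      · exact ⟨0, by simp, .nil t⟩
      · have hlen := List.length_pos_iff.mpr hne
        have hs := List.sum_map_pred_add_length hpos
        obtain ⟨C, hC, hT⟩ := ih _ (by rw [List.length_map]; omega) (h.map_pred hpos) hpred rfl
        rw [List.length_map] at hC hT
        exact ⟨C, by omega, hT⟩
    · obtain ⟨s, rfl⟩ : ∃ s, t = s + 1 := ⟨t - 1, by omega⟩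
      have hs := List.sum_map_pred_add_length hL₁
      simp only [List.sum_append, List.length_append, List.sum_cons, List.length_cons] at ih ⊢
      obtain ⟨C, hC, hT⟩ := ih _ (by rw [List.length_map]; omega) (h₁.map_pred hL₁) hpred rfl
      obtain ⟨C', hC', hT'⟩ := ih _ (by omega) h₂ (t := s) (by omega) rfl
      rw [List.length_map] at hC hT
      refine ⟨_, ?_, (show L₁.length + (L₂.length + 1) = L₁.length + 1 + L₂.length by omega) ▸
        hT.node hT'⟩
      omega

theorem IsRun.exists_shuffleTree {t n : ℕ} {b : ℕ → Fin t → ℕ} {c : ℕ → ℕ}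
    (h : IsRun t n b c) : ∃ C ≤ ∑ k ∈ range n, c k, ShuffleTree t n C := by
  obtain ⟨k, L, hL, rfl, hle⟩ := exists_promiseSeq_of_steps n b c h.2
  obtain ⟨C, hC, hT⟩ := hL.exists_shuffleTree (t := t) ((card_le_univ _).trans_eq (by simp))
  exact ⟨C, by omega, hT⟩

theorem exists_shuffleTree (t n : ℕ) : ∃ C, ShuffleTree (t + 1) n C := by
  induction n with
  | zero => exact ⟨0, .nil _⟩
  | succ n ih =>
    obtain ⟨C, hC⟩ := ih
    exact ⟨_, hC.node (.nil t)⟩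

theorem shuffleTree_shuffleCost (t n : ℕ) :
    ShuffleTree (t + 1) n (shuffleCost (t + 1) n) := by
  obtain ⟨C, hC⟩ := exists_shuffleTree t n
  obtain ⟨b, hb⟩ := hC.exists_shuffleReach
  obtain ⟨s, c, hr, -, hs⟩ := hb.exists_isRun
  obtain ⟨b', c', hr', heq⟩ := Nat.sInf_mem
    (s := { s | ∃ b c, IsRun (t + 1) n b c ∧ s = ∑ k ∈ range n, c k }) ⟨C, s, c, hr, hs⟩
  obtain ⟨C', hle, hT⟩ := hr'.exists_shuffleTree
  have hle' : C' ≤ shuffleCost (t + 1) n := hle.trans_eq heq.symm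
  rwa [hle'.antisymm (shuffleCost_le_of_tree hT)] at hT

theorem shuffleCost_succ_le (t n : ℕ) :
    shuffleCost (t + 1) (n + 1) ≤ shuffleCost (t + 1) n + (n + 1) :=
  shuffleCost_le_of_tree ((shuffleTree_shuffleCost t n).node (.nil t))

theorem ShuffleTree.exists_decomposition {t n C : ℕ} (h : ShuffleTree (t + 2) n C) :
    ∃ (k r : ℕ) (x : Fin k → ℕ), (∀ i, 1 ≤ x i) ∧ ∑ i, x i + r = n ∧
      ∑ i, (shuffleCost (t + 1) (x i) : ℝ) + ∑ i : Fin k, ((k : ℝ) - (i : ℕ)) * (x i : ℝ)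
        + shuffleCost (t + 1) r ≤ C + ∑ i, (x i : ℝ) := by
  generalize hs : t + 2 = s at h
  induction h with
  | nil s => exact ⟨0, 0, Fin.elim0, by simp, by simp, by
      simpa using shuffleCost_le_of_tree (ShuffleTree.nil (t + 1))⟩
  | @node s m r C C' _ h' ih _ =>
    obtain rfl : t + 1 = s := by omega
    obtain ⟨k, r', x, hpos, hsum, hle⟩ := ih rfl
    refine ⟨k + 1, r, Fin.snoc x (r' + 1), fun i => ?_, ?_, ?_⟩
    · refine Fin.lastCases (by simp) (fun j => ?_) i
      simpa using hpos j
    · simp only [Fin.sum_univ_castSucc, Fin.snoc_castSucc, Fin.snoc_last]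
      omega
    · have h₁ : (shuffleCost (t + 1) (r' + 1) : ℝ) ≤ shuffleCost (t + 1) r' + (r' + 1) := by
        exact_mod_cast shuffleCost_succ_le t r'
      have h₂ : (shuffleCost (t + 1) r : ℝ) ≤ C' := by
        exact_mod_cast shuffleCost_le_of_tree h'
      have h₃ : ∑ i, (x i : ℝ) + r' = m := by exact_mod_cast hsum
      have h₄ : ∑ i : Fin k, ((k : ℝ) + 1 - (i : ℕ)) * (x i : ℝ)
          = ∑ i : Fin k, ((k : ℝ) - (i : ℕ)) * (x i : ℝ) + ∑ i, (x i : ℝ) := by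
        rw [← sum_add_distrib]
        exact sum_congr rfl fun i _ => by ring
      simp only [Fin.sum_univ_castSucc, Fin.snoc_castSucc, Fin.snoc_last, Fin.val_castSucc,
        Fin.val_last]
      push_cast
      rw [h₄]
      linarith


/-- Recurrence for the ball-shuffling cost: f_{t+1}(n) is at least the minimum,
over all k ≥ 1 and positive integers x_1, …, x_k summing to n, of
Σ f_t(x_i) + Σ (k − i + 1 − 1/t)·x_i − 2n.  (Stated via an optimal decomposition:
some valid decomposition has its expression below f_{t+1}(n).) -/
theorem shuffleCost_recurrence (t n : ℕ) (ht : 1 ≤ t) (hn : 1 ≤ n) :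
    ∃ (k : ℕ) (x : Fin k → ℕ), 1 ≤ k ∧ (∀ i, 1 ≤ x i) ∧ (∑ i, x i) = n ∧
      (shuffleCost (t + 1) n : ℝ) ≥
        (∑ i, (shuffleCost t (x i) : ℝ)) +
          (∑ i : Fin k, ((k : ℝ) - (i : ℕ) - 1 / (t : ℝ)) * (x i : ℝ)) - 2 * (n : ℝ) := by
  obtain ⟨t, rfl⟩ : ∃ s, t = s + 1 := ⟨t - 1, by omega⟩
  obtain ⟨k, r, x, hpos, hsum, hle⟩ := (shuffleTree_shuffleCost (t + 1) n).exists_decomposition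
  have hsum' : ∑ i, (x i : ℝ) + r = n := by exact_mod_cast hsum
  have drop {l : ℕ} (y : Fin l → ℕ) :
      ∑ i : Fin l, ((l : ℝ) - (i : ℕ) - 1 / ((t + 1 : ℕ) : ℝ)) * (y i : ℝ)
        ≤ ∑ i : Fin l, ((l : ℝ) - (i : ℕ)) * (y i : ℝ) := by
    refine sum_le_sum fun i _ => mul_le_mul_of_nonneg_right ?_ (Nat.cast_nonneg _)
    have : (0 : ℝ) ≤ 1 / ((t + 1 : ℕ) : ℝ) := by positivity
    linarith
  rcases Nat.eq_zero_or_pos r with rfl | hr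
  · refine ⟨k, x, ?_, hpos, by simpa using hsum, ?_⟩
    · rcases Nat.eq_zero_or_pos k with rfl | hk
      · simp at hsum
        omega
      · exact hk
    · have h₁ := drop x
      have h₂ : (0 : ℝ) ≤ shuffleCost (t + 1) 0 := Nat.cast_nonneg _
      have h₃ : (0 : ℝ) ≤ n := Nat.cast_nonneg _
      push_cast at *
      linarith
  · refine ⟨k + 1, Fin.snoc x r, by omega, fun i => ?_, ?_, ?_⟩
    · refine Fin.lastCases (by rwa [Fin.snoc_last]) (fun j => ?_) i
      simpa using hpos j
    · simpa [Fin.sum_univ_castSucc] using hsum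
    · have h₁ := drop (Fin.snoc x r : Fin (k + 1) → ℕ)
      have h₂ : ∑ i : Fin k, ((k : ℝ) + 1 - (i : ℕ)) * (x i : ℝ)
          = ∑ i : Fin k, ((k : ℝ) - (i : ℕ)) * (x i : ℝ) + ∑ i, (x i : ℝ) := by
        rw [← sum_add_distrib]
        exact sum_congr rfl fun i _ => by ring
      have h₃ : (0 : ℝ) ≤ r := Nat.cast_nonneg _
      have h₄ : ∑ i : Fin (k + 1), (((k + 1 : ℕ) : ℝ) - (i : ℕ))
            * ((Fin.snoc x r : Fin (k + 1) → ℕ) i : ℝ)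
          = ∑ i : Fin k, ((k : ℝ) - (i : ℕ)) * (x i : ℝ) + ∑ i, (x i : ℝ) + r := by
        simp only [Fin.sum_univ_castSucc, Fin.snoc_castSucc, Fin.snoc_last, Fin.val_castSucc,
          Fin.val_last]
        push_cast
        rw [h₂]
        ring
      have h₅ : ∑ i : Fin (k + 1),
            (shuffleCost (t + 1) ((Fin.snoc x r : Fin (k + 1) → ℕ) i) : ℝ)
          = ∑ i, (shuffleCost (t + 1) (x i) : ℝ) + shuffleCost (t + 1) r := by
        simp only [Fin.sum_univ_castSucc, Fin.snoc_castSucc, Fin.snoc_last]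
      rw [h₄] at h₁
      rw [h₅]
      linarith
end

section
/- Upper bound for many bins: for all integers s ≥ 2 and m ≥ 1, the ball-shuffling problem with n = s^m balls and t = s·m bins can be solved with total cost at most m·s^m, i.e., f_{s·m}(s^m) ≤ m·s^m. (Divide the bins into m groups of s; fill the bins of group i and, whenever group i is full, merge all its balls into one empty bin of group i+1, so that each ball visits exactly m bins.) -/
/-- The digits of `k` in base `s`, with the digit at position `M` absorbing all higher ones. -/
def truncatedDigit (s M k j : ℕ) : ℕ :=
  if j < M then k / s ^ j % s else k / s ^ j

/-- After `k` balls, group `j` has `truncatedDigit s M k j` bins of size `s ^ j`; bin `i` is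
the bin number `i.divNat` of the group `i.modNat`. -/
def digitConfig (s M k : ℕ) (i : Fin (s * (M + 1))) : ℕ :=
  if (i.divNat : ℕ) < truncatedDigit s M k i.modNat then s ^ (i.modNat : ℕ) else 0

/-- The bins merged when ball `k` arrives: the groups below the top one whose digit carries. -/
def carryBins (s M k : ℕ) : Finset (Fin (s * (M + 1))) :=
  {i | (i.modNat : ℕ) < M ∧ s ^ ((i.modNat : ℕ) + 1) ∣ k + 1}

theorem sum_range_digit_mul_pow (s k M : ℕ) :
    ∑ j ∈ Finset.range M, k / s ^ j % s * s ^ j = k % s ^ M := by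
  induction M with
  | zero => simp [Nat.mod_one]
  | succ M ih => rw [Finset.sum_range_succ, ih, pow_succ, Nat.mod_mul, mul_comm (s ^ M)]

theorem sum_range_truncatedDigit_mul_pow (s k M : ℕ) :
    ∑ j ∈ Finset.range (M + 1), truncatedDigit s M k j * s ^ j = k := by
  have h : ∀ j ∈ Finset.range M, truncatedDigit s M k j * s ^ j = k / s ^ j % s * s ^ j := by
    intro j hj
    rw [truncatedDigit, if_pos (Finset.mem_range.1 hj)]
  rw [Finset.sum_range_succ, Finset.sum_congr rfl h, sum_range_digit_mul_pow, truncatedDigit,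
    if_neg (lt_irrefl M), mul_comm, Nat.mod_add_div]

theorem truncatedDigit_le {s M k j : ℕ} (hs : 0 < s) (hk : k ≤ s ^ (M + 1)) (hj : j ≤ M) :
    truncatedDigit s M k j ≤ s := by
  unfold truncatedDigit
  split_ifs with h
  · exact (Nat.mod_lt _ hs).le
  · obtain rfl : j = M := by omega
    exact Nat.div_le_of_le_mul (by rwa [← pow_succ])

theorem truncatedDigit_le_succ {s M k j : ℕ} (h : ¬(j < M ∧ s ^ (j + 1) ∣ k + 1)) :
    truncatedDigit s M k j ≤ truncatedDigit s M (k + 1) j := by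
  unfold truncatedDigit
  split_ifs with hj
  · rw [Nat.succ_div]
    split_ifs with hd
    · have hns : ¬s ∣ k / s ^ j + 1 := by
        intro hdvd
        apply h
        refine ⟨hj, ?_⟩
        have hq : (k + 1) / s ^ j = k / s ^ j + 1 := by rw [Nat.succ_div, if_pos hd]
        rw [← Nat.mul_div_cancel' hd, hq, pow_succ]
        exact mul_dvd_mul_left _ hdvd
      have hmod : (k / s ^ j + 1) % s = k / s ^ j % s + 1 := by
        rcases Nat.eq_zero_or_pos s with rfl | hs
        · simp
        · have hlt := Nat.mod_lt (k / s ^ j) hs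
          have hne : k / s ^ j % s + 1 ≠ s := fun he => hns <| Nat.dvd_of_mod_eq_zero <| by
            rw [← Nat.mod_add_mod, he, Nat.mod_self]
          rw [← Nat.mod_add_mod, Nat.mod_eq_of_lt (by omega)]
      omega
    · simp
  · exact Nat.div_le_div_right k.le_succ

theorem sum_fin_divNat_modNat {s m : ℕ} (f : ℕ → ℕ → ℕ) :
    ∑ i : Fin (s * m), f i.divNat i.modNat =
      ∑ j ∈ Finset.range m, ∑ p ∈ Finset.range s, f p j := by
  rw [Finset.sum_comm, ← finProdFinEquiv.sum_comp, Fintype.sum_prod_type, Finset.sum_range]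
  refine Finset.sum_congr rfl fun p _ => ?_
  rw [Finset.sum_range]
  refine Finset.sum_congr rfl fun j _ => ?_
  have h := finProdFinEquiv.symm_apply_apply (p, j)
  rw [finProdFinEquiv_symm_apply, Prod.mk.injEq] at h
  rw [h.1, h.2]

theorem sum_range_ite_lt_const {s d : ℕ} (hd : d ≤ s) (w : ℕ) :
    (∑ p ∈ Finset.range s, if p < d then w else 0) = d * w := by
  have h : {p ∈ Finset.range s | p < d} = Finset.range d := by
    ext p
    simp only [Finset.mem_filter, Finset.mem_range]
    omega
  rw [← Finset.sum_filter, h, Finset.sum_const, Finset.card_range, smul_eq_mul]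

theorem sum_digitConfig {s M k : ℕ} (hs : 0 < s) (hk : k ≤ s ^ (M + 1)) :
    ∑ i, digitConfig s M k i = k := by
  unfold digitConfig
  rw [sum_fin_divNat_modNat fun p j => if p < truncatedDigit s M k j then s ^ j else 0]
  refine Eq.trans (Finset.sum_congr rfl fun j hj => ?_) (sum_range_truncatedDigit_mul_pow s k M)
  exact sum_range_ite_lt_const
    (truncatedDigit_le hs hk (Nat.lt_succ_iff.1 (Finset.mem_range.1 hj))) _

theorem shuffleStep_digitConfig {s M k : ℕ} (hs : 0 < s) (hk : k < s ^ (M + 1)) :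
    ShuffleStep (s * (M + 1)) (digitConfig s M k) (digitConfig s M (k + 1))
      (∑ i ∈ carryBins s M k, digitConfig s M k i + 1) := by
  refine ⟨carryBins s M k, rfl, fun i hi hne => ?_, ?_⟩
  · have hle := truncatedDigit_le_succ fun h => hi (Finset.mem_filter.2 ⟨Finset.mem_univ i, h⟩)
    unfold digitConfig at hne ⊢
    split_ifs at hne with hlt
    · rw [if_pos hlt, if_pos (hlt.trans_le hle)]
    · exact absurd rfl hne
  · rw [sum_digitConfig hs hk, sum_digitConfig hs hk.le]

theorem sum_carryBins_le (s M k : ℕ) :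
    ∑ i ∈ carryBins s M k, digitConfig s M k i ≤
      ∑ j ∈ Finset.range M, if s ^ (j + 1) ∣ k + 1 then s ^ (j + 1) else 0 := by
  let f : ℕ → ℕ → ℕ := fun _ j => if j < M ∧ s ^ (j + 1) ∣ k + 1 then s ^ j else 0
  calc ∑ i ∈ carryBins s M k, digitConfig s M k i
      ≤ ∑ i : Fin (s * (M + 1)), f i.divNat i.modNat := by
        rw [carryBins, Finset.sum_filter]
        refine Finset.sum_le_sum fun i _ => ?_
        simp only [f, digitConfig]
        split_ifs <;> simp
    _ = ∑ j ∈ Finset.range M, if s ^ (j + 1) ∣ k + 1 then s ^ (j + 1) else 0 := by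
        rw [sum_fin_divNat_modNat f, Finset.sum_range_succ]
        simp only [f, lt_irrefl, false_and, if_false, Finset.sum_const_zero, add_zero]
        refine Finset.sum_congr rfl fun j hj => ?_
        simp only [Finset.mem_range.1 hj, true_and, Finset.sum_const, Finset.card_range,
          smul_eq_mul, mul_ite, mul_zero, pow_succ']

theorem sum_range_ite_dvd_succ_le (n d : ℕ) :
    (∑ k ∈ Finset.range n, if d ∣ k + 1 then d else 0) ≤ n := by
  rw [← Finset.sum_filter, Finset.sum_const, smul_eq_mul, Nat.card_multiples]
  exact Nat.div_mul_le_self n d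

theorem sum_cost_digitConfig_le (s M n : ℕ) :
    ∑ k ∈ Finset.range n, (∑ i ∈ carryBins s M k, digitConfig s M k i + 1) ≤ (M + 1) * n := by
  rw [Finset.sum_add_distrib, Finset.sum_const, Finset.card_range, smul_eq_mul, mul_one, add_mul,
    one_mul]
  gcongr
  calc ∑ k ∈ Finset.range n, ∑ i ∈ carryBins s M k, digitConfig s M k i
      ≤ ∑ k ∈ Finset.range n, ∑ j ∈ Finset.range M,
          (if s ^ (j + 1) ∣ k + 1 then s ^ (j + 1) else 0) :=
        Finset.sum_le_sum fun k _ => sum_carryBins_le s M k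
    _ = ∑ j ∈ Finset.range M, ∑ k ∈ Finset.range n,
          (if s ^ (j + 1) ∣ k + 1 then s ^ (j + 1) else 0) := Finset.sum_comm
    _ ≤ ∑ _j ∈ Finset.range M, n :=
        Finset.sum_le_sum fun j _ => sum_range_ite_dvd_succ_le n (s ^ (j + 1))
    _ = M * n := by simp

/-- Upper bound for many bins: with t = s·m bins one can handle n = s^m balls at
total cost at most m·s^m, by dividing the bins into m groups of s and merging
each full group into one bin of the next group. -/
theorem shuffleCost_many_bins_upper_bound (s m : ℕ) (hs : 2 ≤ s) (hm : 1 ≤ m) :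
    shuffleCost (s * m) (s ^ m) ≤ m * s ^ m := by
  obtain ⟨M, rfl⟩ : ∃ M, m = M + 1 := ⟨m - 1, by omega⟩
  have hs' : 0 < s := by omega
  refine (Nat.sInf_le ?_).trans (sum_cost_digitConfig_le s M (s ^ (M + 1)))
  refine ⟨digitConfig s M, _, ⟨fun i => ?_, fun k hk => shuffleStep_digitConfig hs' hk⟩, rfl⟩
  simp [digitConfig, truncatedDigit]
end

section
/- For all real numbers t > 0 and n ≥ 2, if x := t / log₂ n satisfies x ≥ 2, then (t / log_x n)^{log_x n} ≥ n, where log_x denotes the logarithm to base x and log₂ the logarithm to base 2. (Equivalently, (t/log_x n)^{log_x n} = n·(log₂ x)^{log_x n} ≥ n.) -/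
/-- For reals t > 0 and n ≥ 2, if x := t / log₂ n satisfies x ≥ 2, then
(t / log_x n)^{log_x n} ≥ n: the capacity of the last group in the grouping
strategy is at least n. -/
theorem group_capacity_inequality (t n : ℝ) (ht : 0 < t) (hn : 2 ≤ n)
    (hx : 2 ≤ t / Real.logb 2 n) :
    (t / Real.logb (t / Real.logb 2 n) n) ^ Real.logb (t / Real.logb 2 n) n ≥ n := by
  set x := t / Real.logb 2 n
  have hx1 : 1 < x := by linarith
  have hk : 0 < Real.logb x n := Real.logb_pos hx1 (by linarith)
  have hlog : 1 ≤ Real.logb 2 x := by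
    rw [Real.le_logb_iff_rpow_le (by norm_num) (by linarith)]
    simpa using hx
  have hbase : Real.logb 2 x * Real.logb x n = Real.logb 2 n :=
    Real.mul_logb (by linarith) (by linarith) (by linarith)
  have hxle : x ≤ t / Real.logb x n := by
    refine div_le_div_of_nonneg_left ht.le hk ?_
    nlinarith
  calc n = x ^ Real.logb x n :=
        (Real.rpow_logb (by linarith) hx1.ne' (by linarith)).symm
    _ ≤ _ := Real.rpow_le_rpow (by linarith) hxle hk.le
end

section
/- Upper bound for few bins: there exists a constant c > 0 such that for all integers n ≥ 1 and t ≥ 1, the optimal ball-shuffling cost satisfies f_t(n) ≤ c·t·n^{1+1/t}. -/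
/-- The configuration holding `k` balls in base `m`: bin `i` holds the value of the `i`-th digit. -/
def digitBins (t m k : ℕ) (i : Fin t) : ℕ := k / m ^ (i : ℕ) % m * m ^ (i : ℕ)

/-- The cost of moving from `digitBins t m k` to `digitBins t m (k + 1)`. -/
def digitCost (t m k : ℕ) : ℕ :=
  (∑ i ∈ Finset.univ.filter fun i : Fin t => m ^ (i : ℕ) ∣ k + 1, digitBins t m k i) + 1

theorem sum_digitBins (t m k : ℕ) : ∑ i, digitBins t m k i = k % m ^ t := by
  induction t with
  | zero => simp [Nat.mod_one]
  | succ t ih =>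
    rw [Fin.sum_univ_castSucc, pow_succ, Nat.mod_mul, ← ih, mul_comm (m ^ t)]
    simp [digitBins]

theorem isRun_digitBins {t m n : ℕ} (h : n < m ^ t) :
    IsRun t n (digitBins t m) (digitCost t m) := by
  refine ⟨fun i => by simp [digitBins], fun k hk => ⟨_, rfl, fun i hi _ => ?_, ?_⟩⟩
  · have hi : ¬ m ^ (i : ℕ) ∣ k + 1 := by simpa using hi
    simp [digitBins, Nat.succ_div, hi]
  · rw [sum_digitBins, sum_digitBins, Nat.mod_eq_of_lt (by omega), Nat.mod_eq_of_lt (by omega)]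

theorem sum_digitCost_le {m : ℕ} (hm : 0 < m) (t n : ℕ) :
    ∑ k ∈ Finset.range n, digitCost t m k ≤ t * (m * n) + n := by
  simp only [digitCost, Finset.sum_add_distrib, Finset.sum_const, Finset.card_range,
    smul_eq_mul, mul_one, Finset.sum_filter]
  rw [Finset.sum_comm]
  refine Nat.add_le_add_right ?_ n
  have key (i : Fin t) :
      (∑ k ∈ Finset.range n, if m ^ (i : ℕ) ∣ k + 1 then digitBins t m k i else 0) ≤ m * n := by
    rw [← Finset.sum_filter]
    calc
      _ ≤ ((Finset.range n).filter fun k => m ^ (i : ℕ) ∣ k + 1).card • (m * m ^ (i : ℕ)) :=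
        Finset.sum_le_card_nsmul _ _ _ fun k _ =>
          Nat.mul_le_mul_right _ (Nat.mod_lt _ hm).le
      _ = m * (n / m ^ (i : ℕ) * m ^ (i : ℕ)) := by
        rw [Nat.card_multiples, smul_eq_mul]
        ring
      _ ≤ m * n := Nat.mul_le_mul_left _ (Nat.div_mul_le_self _ _)
  simpa using Finset.sum_le_sum fun i (_ : i ∈ Finset.univ) => key i

theorem shuffleCost_le {t m n : ℕ} (hm : 0 < m) (h : n < m ^ t) :
    shuffleCost t n ≤ t * (m * n) + n := by
  refine le_trans (Nat.sInf_le ?_) (sum_digitCost_le hm t n)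
  exact ⟨_, _, isRun_digitBins h, rfl⟩

/-- Upper bound for few bins: there is a constant c > 0 such that for all
n ≥ 1 and t ≥ 1, f_t(n) ≤ c·t·n^{1+1/t}. -/
theorem shuffleCost_upper_bound_few_bins :
    ∃ c : ℝ, 0 < c ∧ ∀ n t : ℕ, 1 ≤ n → 1 ≤ t →
      (shuffleCost t n : ℝ) ≤ c * (t : ℝ) * (n : ℝ) ^ (1 + 1 / (t : ℝ)) := by
  refine ⟨3, by norm_num, fun n t hn ht => ?_⟩
  have hn1 : (1 : ℝ) ≤ n := by exact_mod_cast hn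
  have ht1 : (1 : ℝ) ≤ t := by exact_mod_cast ht
  set x : ℝ := (n : ℝ) ^ (1 / (t : ℝ)) with hx
  have hx1 : 1 ≤ x := Real.one_le_rpow hn1 (by positivity)
  have hxt : x ^ t = n := by
    rw [hx, one_div, Real.rpow_inv_natCast_pow (by positivity) (by omega)]
  have hlt : n < (⌊x⌋₊ + 1) ^ t := by
    have : (n : ℝ) < ((⌊x⌋₊ : ℝ) + 1) ^ t := by
      rw [← hxt]
      exact pow_lt_pow_left₀ (Nat.lt_floor_add_one x) (by positivity) (by omega)
    exact_mod_cast this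
  have hcost : (shuffleCost t n : ℝ) ≤ t * (((⌊x⌋₊ : ℝ) + 1) * n) + n := by
    exact_mod_cast shuffleCost_le (Nat.succ_pos _) hlt
  rw [Real.rpow_add (by positivity), Real.rpow_one, ← hx]
  have hfloor : (⌊x⌋₊ : ℝ) + 1 ≤ 2 * x := by
    linarith [Nat.floor_le (zero_le_one.trans hx1)]
  have htx : 1 ≤ t * x := one_le_mul_of_one_le_of_one_le ht1 hx1
  calc
    (shuffleCost t n : ℝ) ≤ t * (((⌊x⌋₊ : ℝ) + 1) * n) + 1 * n := by rwa [one_mul]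
    _ ≤ t * (2 * x * n) + t * x * n := by gcongr
    _ = 3 * t * (n * x) := by ring
end

section
/- Key analytic inequality of the phase-one induction: let c₁ > 0 and 0 < c₂ < 1 be reals, t ≥ 1 an integer, and n ≥ 1 a real number, and set γ = (t/(t+1))^{t/c₂} · n^{1/(t+1)}. If γ ≥ (4·c₁·c₂·e)^{1/(1−c₂)}, then for all λ ∈ [0,1]: (t/(t+1)) · n^{c₂/(t(t+1))} · λ^{1+c₂/t} + (1−λ)^{1+c₂/t} ≥ 1 − 1/(2·c₁·(t+1)·n^{c₂/(t+1)}). -/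
/-- The minimum over `l ∈ [0, 1]` of `g ^ a * l ^ (1 + a) + (1 - l) ^ (1 + a)` is attained at
`l = 1 / (1 + g)`, with value `(g / (1 + g)) ^ a`. -/
theorem rpow_div_one_add_le_mul_rpow_add_rpow {g a l : ℝ} (hg : 0 < g) (ha : 0 ≤ a)
    (hl0 : 0 ≤ l) (hl1 : l ≤ 1) :
    (g / (1 + g)) ^ a ≤ g ^ a * l ^ (1 + a) + (1 - l) ^ (1 + a) := by
  have hg1 : 0 < 1 + g := by linarith
  have hm : 0 ≤ (g / (1 + g)) ^ a := by positivity
  have bernoulli : ∀ x : ℝ, 0 ≤ x → 1 + (1 + a) * (x - 1) ≤ x ^ (1 + a) := fun x hx => by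
    simpa using one_add_mul_self_le_rpow_one_add (s := x - 1) (by linarith)
      (p := 1 + a) (by linarith)
  have hleft : g ^ a * l ^ (1 + a)
      = (g / (1 + g)) ^ a * (1 / (1 + g) * (l * (1 + g)) ^ (1 + a)) := by
    rw [Real.mul_rpow hl0 hg1.le, Real.div_rpow hg.le hg1.le, Real.rpow_add hg1, Real.rpow_one]
    field_simp
  have hright : (1 - l) ^ (1 + a)
      = (g / (1 + g)) ^ a * (g / (1 + g) * ((1 - l) * ((1 + g) / g)) ^ (1 + a)) := by
    rw [Real.mul_rpow (by linarith) (by positivity), Real.div_rpow hg.le hg1.le,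
      Real.div_rpow hg1.le hg.le, Real.rpow_add hg1, Real.rpow_add hg, Real.rpow_one,
      Real.rpow_one]
    field_simp
  rw [hleft, hright, ← mul_add]
  refine le_mul_of_one_le_right hm ?_
  calc (1 : ℝ) = 1 / (1 + g) * (1 + (1 + a) * (l * (1 + g) - 1))
        + g / (1 + g) * (1 + (1 + a) * ((1 - l) * ((1 + g) / g) - 1)) := by
        field_simp
        ring
    _ ≤ _ := by
        gcongr
        · exact bernoulli _ (by positivity)
        · exact bernoulli _ (mul_nonneg (by linarith) (by positivity))

theorem one_sub_div_le_rpow_div_one_add {g a : ℝ} (hg : 0 < g) (ha : 0 ≤ a) :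
    1 - a / g ≤ (g / (1 + g)) ^ a := by
  have hlog : -(1 / g) ≤ Real.log (g / (1 + g)) := by
    have h := Real.one_sub_inv_le_log_of_pos (x := g / (1 + g)) (by positivity)
    have e : 1 - (g / (1 + g))⁻¹ = -(1 / g) := by
      field_simp
      ring
    linarith
  rw [Real.rpow_def_of_pos (by positivity)]
  have h1 := Real.add_one_le_exp (Real.log (g / (1 + g)) * a)
  have h2 := mul_le_mul_of_nonneg_right hlog ha
  have e : -(1 / g) * a = -(a / g) := by ring
  linarith

theorem one_le_exp_one_mul_div_add_one_pow {t : ℕ} (ht : 1 ≤ t) :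
    1 ≤ Real.exp 1 * ((t : ℝ) / ((t : ℝ) + 1)) ^ t := by
  have ht0 : (0 : ℝ) < t := by exact_mod_cast ht
  have h : ((t : ℝ) + 1) / t ≤ Real.exp (1 / t) := by
    have h1 := Real.add_one_le_exp (1 / (t : ℝ))
    have e : ((t : ℝ) + 1) / t = 1 / t + 1 := by field_simp; ring
    linarith
  have hexp : Real.exp (1 / (t : ℝ)) ^ t = Real.exp 1 := by
    rw [← Real.exp_nat_mul]
    congr 1
    field_simp
  rw [← hexp, ← mul_pow]
  refine one_le_pow₀ ?_
  calc (1 : ℝ) = ((t : ℝ) + 1) / t * (t / (t + 1)) := by field_simp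
    _ ≤ _ := by gcongr


/-- Key analytic inequality of the phase-one induction (inequality (9)):
for reals c₁ > 0, 0 < c₂ < 1, integer t ≥ 1, real n ≥ 1, with
γ = (t/(t+1))^{t/c₂}·n^{1/(t+1)} ≥ (4c₁c₂e)^{1/(1−c₂)}, for all λ ∈ [0,1]:
(t/(t+1))·n^{c₂/(t(t+1))}·λ^{1+c₂/t} + (1−λ)^{1+c₂/t}
  ≥ 1 − 1/(2c₁(t+1)n^{c₂/(t+1)}). -/
theorem phase_one_key_inequality (c₁ c₂ : ℝ) (t : ℕ) (n : ℝ)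
    (hc₁ : 0 < c₁) (hc₂ : 0 < c₂) (hc₂' : c₂ < 1) (ht : 1 ≤ t) (hn : 1 ≤ n)
    (hγ : (4 * c₁ * c₂ * Real.exp 1) ^ (1 / (1 - c₂)) ≤
      ((t : ℝ) / ((t : ℝ) + 1)) ^ ((t : ℝ) / c₂) * n ^ (1 / ((t : ℝ) + 1))) :
    ∀ l ∈ Set.Icc (0 : ℝ) 1,
      ((t : ℝ) / ((t : ℝ) + 1)) * n ^ (c₂ / ((t : ℝ) * ((t : ℝ) + 1))) *
          l ^ (1 + c₂ / (t : ℝ)) + (1 - l) ^ (1 + c₂ / (t : ℝ)) ≥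
        1 - 1 / (2 * c₁ * ((t : ℝ) + 1) * n ^ (c₂ / ((t : ℝ) + 1))) := by
  rintro l ⟨hl0, hl1⟩
  have ht0 : (0 : ℝ) < t := by exact_mod_cast ht
  have ht1 : (1 : ℝ) ≤ t := by exact_mod_cast ht
  have hn0 : 0 < n := by linarith
  set r : ℝ := (t : ℝ) / ((t : ℝ) + 1) with hr
  have hr0 : 0 < r := by positivity
  set g : ℝ := r ^ ((t : ℝ) / c₂) * n ^ (1 / ((t : ℝ) + 1)) with hg
  have hg0 : 0 < g := by positivity
  have hga : g ^ (c₂ / (t : ℝ)) = r * n ^ (c₂ / ((t : ℝ) * ((t : ℝ) + 1))) := by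
    rw [hg, Real.mul_rpow (by positivity) (by positivity), ← Real.rpow_mul hr0.le,
      ← Real.rpow_mul hn0.le, show (t : ℝ) / c₂ * (c₂ / t) = 1 by field_simp, Real.rpow_one]
    congr 2
    field_simp
  have hgc : g ^ c₂ = r ^ t * n ^ (c₂ / ((t : ℝ) + 1)) := by
    rw [hg, Real.mul_rpow (by positivity) (by positivity), ← Real.rpow_mul hr0.le,
      ← Real.rpow_mul hn0.le, show (t : ℝ) / c₂ * c₂ = t by field_simp, Real.rpow_natCast]
    congr 2
    field_simp
  have hN : n ^ (c₂ / ((t : ℝ) + 1)) ≤ Real.exp 1 * g ^ c₂ := by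
    rw [hgc, ← mul_assoc]
    exact le_mul_of_one_le_left (by positivity) (one_le_exp_one_mul_div_add_one_pow ht)
  have hX : 4 * c₁ * c₂ * Real.exp 1 ≤ g ^ (1 - c₂) := by
    have hc : 0 < 1 - c₂ := by linarith
    have h := Real.rpow_le_rpow (by positivity) hγ hc.le
    rwa [← Real.rpow_mul (by positivity), one_div_mul_cancel hc.ne', Real.rpow_one] at h
  have hgg : g ^ (1 - c₂) * g ^ c₂ = g := by
    rw [← Real.rpow_add hg0, sub_add_cancel, Real.rpow_one]
  have hmin := rpow_div_one_add_le_mul_rpow_add_rpow hg0 (a := c₂ / t) (by positivity) hl0 hl1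
  have hlow := one_sub_div_le_rpow_div_one_add hg0 (a := c₂ / t) (by positivity)
  have hkey : c₂ / t / g ≤ 1 / (2 * c₁ * ((t : ℝ) + 1) * n ^ (c₂ / ((t : ℝ) + 1))) := by
    rw [div_div, div_le_div_iff₀ (by positivity) (by positivity), one_mul]
    calc c₂ * (2 * c₁ * ((t : ℝ) + 1) * n ^ (c₂ / ((t : ℝ) + 1)))
        ≤ c₂ * (2 * c₁ * ((t : ℝ) + t) * (Real.exp 1 * g ^ c₂)) := by gcongr
      _ = t * (4 * c₁ * c₂ * Real.exp 1 * g ^ c₂) := by ring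
      _ ≤ t * (g ^ (1 - c₂) * g ^ c₂) := by gcongr
      _ = t * g := by rw [hgg]
  rw [hga] at hmin
  linarith
end

section
/- For all real numbers c₁ > 0, 0 < c₂ < 1, t ≥ 1, and γ > 0 with γ ≥ (4·c₁·c₂·e)^{1/(1−c₂)}, we have (γ/(γ+1))^{c₂/t} ≥ 1 − 1/(4·c₁·e·t·γ^{c₂}). -/
/-- For reals c₁ > 0, 0 < c₂ < 1, t ≥ 1 and γ > 0 with
γ ≥ (4c₁c₂e)^{1/(1−c₂)}, we have (γ/(γ+1))^{c₂/t} ≥ 1 − 1/(4c₁·e·t·γ^{c₂}). -/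
theorem phase_one_final_inequality (c₁ c₂ t γ : ℝ)
    (hc₁ : 0 < c₁) (hc₂ : 0 < c₂) (hc₂' : c₂ < 1) (ht : 1 ≤ t) (hγ0 : 0 < γ)
    (hγ : (4 * c₁ * c₂ * Real.exp 1) ^ (1 / (1 - c₂)) ≤ γ) :
    (γ / (γ + 1)) ^ (c₂ / t) ≥ 1 - 1 / (4 * c₁ * Real.exp 1 * t * γ ^ c₂) := by
  have ht0 : 0 < t := by linarith
  have hs : 0 < 1 - c₂ := by linarith
  have hA : 0 ≤ 4 * c₁ * c₂ * Real.exp 1 := by positivity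
  have hpow : 4 * c₁ * c₂ * Real.exp 1 ≤ γ ^ (1 - c₂) := by
    have h := Real.rpow_le_rpow (by positivity) hγ hs.le
    rwa [← Real.rpow_mul hA, one_div_mul_cancel hs.ne', Real.rpow_one] at h
  have hprod : 4 * c₁ * c₂ * Real.exp 1 * γ ^ c₂ ≤ γ := by
    calc 4 * c₁ * c₂ * Real.exp 1 * γ ^ c₂ ≤ γ ^ (1 - c₂) * γ ^ c₂ := by gcongr
      _ = γ := by rw [← Real.rpow_add hγ0, sub_add_cancel, Real.rpow_one]
  have hbound : c₂ / (t * γ) ≤ 1 / (4 * c₁ * Real.exp 1 * t * γ ^ c₂) := by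
    rw [div_le_div_iff₀ (by positivity) (by positivity)]
    calc c₂ * (4 * c₁ * Real.exp 1 * t * γ ^ c₂)
        = t * (4 * c₁ * c₂ * Real.exp 1 * γ ^ c₂) := by ring
      _ ≤ t * γ := by gcongr
      _ = 1 * (t * γ) := by ring
  have hlog : -(1 / γ) ≤ Real.log (γ / (γ + 1)) := by
    have h := Real.one_sub_inv_le_log_of_pos (show 0 < γ / (γ + 1) by positivity)
    have heq : 1 - (γ / (γ + 1))⁻¹ = -(1 / γ) := by
      field_simp
      ring
    rwa [heq] at h
  calc 1 - 1 / (4 * c₁ * Real.exp 1 * t * γ ^ c₂)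
      ≤ 1 - c₂ / (t * γ) := by linarith
    _ = -(1 / γ) * (c₂ / t) + 1 := by
      field_simp
      ring
    _ ≤ Real.log (γ / (γ + 1)) * (c₂ / t) + 1 := by gcongr
    _ ≤ Real.exp (Real.log (γ / (γ + 1)) * (c₂ / t)) := Real.add_one_le_exp _
    _ = (γ / (γ + 1)) ^ (c₂ / t) := (Real.rpow_def_of_pos (by positivity) _).symm
end
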